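/- arXiv:2405.05968 — 11 statements merged into one kernel-verified Lean document; each statement's English description precedes it below -/
import Mathlib

section
/- Assume Φ: ℝ → ℝ is nonnegative, convex, and differentiable at 0 with Φ′(0) > 0. Then for every t ∈ [0,1] and every u ≤ 0 one has f_t(u) ≥ f_t(0); consequently the infimum of f_t over (−∞, 0] equals f_t(0), and the transformation satisfies T(t) = f_t(0) − inf_{u ∈ ℝ} f_t(u) for all t ∈ [0,1]. -/
open Set

/-- The function `f_t(u) = ((1-t)/2)·Φ(u) + ((1+t)/2)·Φ(-u)`. -/
noncomputable def ftrans (Φ : ℝ → ℝ) (t u : ℝ) : ℝ :=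
  ((1 - t) / 2) * Φ u + ((1 + t) / 2) * Φ (-u)

/-- The transformation `T(t) = inf_{u ≤ 0} f_t(u) - inf_{u ∈ ℝ} f_t(u)`. -/
noncomputable def Ttrans (Φ : ℝ → ℝ) (t : ℝ) : ℝ :=
  sInf (ftrans Φ t '' Set.Iic 0) - sInf (ftrans Φ t '' Set.univ)

/-- A convex function on `ℝ` lies above its tangent line. -/
theorem ConvexOn.add_deriv_mul_le {f : ℝ → ℝ} (hf : ConvexOn ℝ Set.univ f) {x : ℝ}
    (hx : DifferentiableAt ℝ f x) (y : ℝ) : f x + deriv f x * (y - x) ≤ f y := by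
  rcases lt_trichotomy x y with h | rfl | h
  · have := hf.deriv_le_slope (Set.mem_univ x) (Set.mem_univ y) h hx
    rw [slope_def_field, le_div_iff₀ (sub_pos.2 h)] at this
    linarith
  · simp
  · have := hf.slope_le_deriv (Set.mem_univ y) (Set.mem_univ x) h hx
    rw [slope_def_field, div_le_iff₀ (sub_pos.2 h)] at this
    linarith

theorem stmt0 (Φ : ℝ → ℝ) (hnn : ∀ x, 0 ≤ Φ x) (hconv : ConvexOn ℝ Set.univ Φ)
    (hdiff : DifferentiableAt ℝ Φ 0) (hpos : 0 < deriv Φ 0) :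
    ∀ t ∈ Set.Icc (0 : ℝ) 1,
      (∀ u ≤ (0 : ℝ), ftrans Φ t 0 ≤ ftrans Φ t u) ∧
      sInf (ftrans Φ t '' Set.Iic 0) = ftrans Φ t 0 ∧
      Ttrans Φ t = ftrans Φ t 0 - sInf (ftrans Φ t '' Set.univ) := by
  rintro t ⟨ht0, ht1⟩
  have hmin : ∀ u ≤ (0 : ℝ), ftrans Φ t 0 ≤ ftrans Φ t u := by
    intro u hu
    have h1 := mul_le_mul_of_nonneg_left (hconv.add_deriv_mul_le hdiff u)
      (by linarith : 0 ≤ (1 - t) / 2)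
    have h2 := mul_le_mul_of_nonneg_left (hconv.add_deriv_mul_le hdiff (-u))
      (by linarith : 0 ≤ (1 + t) / 2)
    have h3 : 0 ≤ t * deriv Φ 0 * -u :=
      mul_nonneg (mul_nonneg ht0 hpos.le) (neg_nonneg.2 hu)
    simp only [ftrans, neg_zero]
    linarith
  have hinf : sInf (ftrans Φ t '' Set.Iic 0) = ftrans Φ t 0 :=
    IsLeast.csInf_eq ⟨Set.mem_image_of_mem _ Set.self_mem_Iic, by
      rintro _ ⟨u, hu, rfl⟩
      exact hmin u hu⟩
  exact ⟨hmin, hinf, by rw [Ttrans, hinf]⟩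
end

section
/- Assume Φ: ℝ → ℝ is nonnegative, convex, twice continuously differentiable, and satisfies Φ′(0) > 0 and Φ″(0) > 0. Then T(t) = Θ(t²) near zero: there exist positive constants C > 0, c > 0 and T₀ > 0 such that for all t with 0 < t ≤ T₀, c·t² ≤ T(t) ≤ C·t². -/
open Set

/-- A function that is twice continuously differentiable, with positive second derivative at `0`,
is squeezed between two quadratics near `0`. -/
theorem exists_quadratic_bounds {Φ : ℝ → ℝ} (hC2 : ContDiff ℝ 2 Φ)
    (hd2 : 0 < iteratedDeriv 2 Φ 0) :
    ∃ δ > (0 : ℝ), ∀ u : ℝ, |u| ≤ δ →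
      Φ 0 + deriv Φ 0 * u + iteratedDeriv 2 Φ 0 / 4 * u ^ 2 ≤ Φ u ∧
      Φ u ≤ Φ 0 + deriv Φ 0 * u + iteratedDeriv 2 Φ 0 * u ^ 2 := by
  have h := (taylor_isLittleO_univ (x₀ := 0) (n := 2) hC2).def
    (show 0 < iteratedDeriv 2 Φ 0 / 4 by positivity)
  obtain ⟨r, hr, hball⟩ := Metric.eventually_nhds_iff.1 h
  refine ⟨r / 2, by positivity, fun u hu => ?_⟩
  have hu' := hball (y := u) (by rw [Real.dist_eq, sub_zero]; linarith)
  simp only [taylor_within_apply, Finset.sum_range_succ, Finset.sum_range_zero,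
    iteratedDerivWithin_univ, iteratedDeriv_zero, iteratedDeriv_one, Real.norm_eq_abs,
    sub_zero, smul_eq_mul, Nat.factorial, abs_of_nonneg (sq_nonneg u)] at hu'
  norm_num at hu'
  have h1 := abs_le.1 hu'
  have h2 : 0 ≤ iteratedDeriv 2 Φ 0 * u ^ 2 := by positivity
  constructor <;> linarith [h1.1, h1.2]

/-- A differentiable convex function lies above its tangent line at `0`. -/
theorem ConvexOn.tangent_zero_le {Φ : ℝ → ℝ} (hconv : ConvexOn ℝ univ Φ)
    (hd : DifferentiableAt ℝ Φ 0) (u : ℝ) : Φ 0 + deriv Φ 0 * u ≤ Φ u := by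
  rcases lt_trichotomy u 0 with hu | rfl | hu
  · have h := hconv.slope_le_deriv (mem_univ u) (mem_univ 0) hu hd
    rw [slope_def_field, div_le_iff₀ (by linarith)] at h
    linarith
  · simp
  · have h := hconv.deriv_le_slope (mem_univ 0) (mem_univ u) hu hd
    rw [slope_def_field, le_div_iff₀ (by linarith)] at h
    linarith

theorem ftrans_zero (Φ : ℝ → ℝ) (t : ℝ) : ftrans Φ t 0 = Φ 0 := by
  simp only [ftrans, neg_zero]
  ring

theorem convexOn_ftrans {Φ : ℝ → ℝ} (hconv : ConvexOn ℝ univ Φ) {t : ℝ} (ht0 : 0 ≤ t)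
    (ht1 : t ≤ 1) : ConvexOn ℝ univ (ftrans Φ t) := by
  have hneg : ConvexOn ℝ univ fun u => Φ (-u) := by
    exact hconv.comp_linearMap (-LinearMap.id)
  exact (hconv.smul (show 0 ≤ (1 - t) / 2 by linarith)).add
    (hneg.smul (show 0 ≤ (1 + t) / 2 by linarith))

/-- If `q` bounds `Φ` from below at `u` and `-u`, with `q` a quadratic, then `ftrans Φ t u` is
bounded below by the corresponding combination. -/
theorem le_ftrans_of_quadratic_le {Φ : ℝ → ℝ} {a p b t u : ℝ} (ht0 : 0 ≤ t) (ht1 : t ≤ 1)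
    (h : a + p * u + b * u ^ 2 ≤ Φ u) (h' : a + p * -u + b * (-u) ^ 2 ≤ Φ (-u)) :
    a - t * p * u + b * u ^ 2 ≤ ftrans Φ t u := by
  have h1 := mul_le_mul_of_nonneg_left h (show 0 ≤ (1 - t) / 2 by linarith)
  have h2 := mul_le_mul_of_nonneg_left h' (show 0 ≤ (1 + t) / 2 by linarith)
  unfold ftrans
  linarith

theorem ftrans_le_of_le_quadratic {Φ : ℝ → ℝ} {a p b t u : ℝ} (ht0 : 0 ≤ t) (ht1 : t ≤ 1)
    (h : Φ u ≤ a + p * u + b * u ^ 2) (h' : Φ (-u) ≤ a + p * -u + b * (-u) ^ 2) :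
    ftrans Φ t u ≤ a - t * p * u + b * u ^ 2 := by
  have h1 := mul_le_mul_of_nonneg_left h (show 0 ≤ (1 - t) / 2 by linarith)
  have h2 := mul_le_mul_of_nonneg_left h' (show 0 ≤ (1 + t) / 2 by linarith)
  unfold ftrans
  linarith

/-- If `Φ` has nonnegative derivative at `0`, then `ftrans Φ t` is minimized over `u ≤ 0`
at `u = 0`. -/
theorem le_ftrans_of_nonpos {Φ : ℝ → ℝ} (hconv : ConvexOn ℝ univ Φ)
    (hd : DifferentiableAt ℝ Φ 0) (hd1 : 0 ≤ deriv Φ 0) {t u : ℝ} (ht0 : 0 ≤ t) (ht1 : t ≤ 1)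
    (hu : u ≤ 0) : Φ 0 ≤ ftrans Φ t u := by
  have h := le_ftrans_of_quadratic_le (b := 0) ht0 ht1 (by simpa using hconv.tangent_zero_le hd u)
    (by simpa using hconv.tangent_zero_le hd (-u))
  have := mul_nonneg (mul_nonneg ht0 hd1) (neg_nonneg.2 hu)
  linarith

theorem Ttrans_eq {Φ : ℝ → ℝ} (hconv : ConvexOn ℝ univ Φ) (hd : DifferentiableAt ℝ Φ 0)
    (hd1 : 0 ≤ deriv Φ 0) {t : ℝ} (ht0 : 0 ≤ t) (ht1 : t ≤ 1) :
    Ttrans Φ t = Φ 0 - sInf (ftrans Φ t '' univ) := by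
  have h : IsLeast (ftrans Φ t '' Iic 0) (Φ 0) :=
    ⟨⟨0, self_mem_Iic, ftrans_zero Φ t⟩,
      forall_mem_image.2 fun _ hu => le_ftrans_of_nonpos hconv hd hd1 ht0 ht1 hu⟩
  rw [Ttrans, h.csInf_eq]

theorem stmt1 (Φ : ℝ → ℝ) (hnn : ∀ x, 0 ≤ Φ x) (hconv : ConvexOn ℝ Set.univ Φ)
    (hC2 : ContDiff ℝ 2 Φ) (hd1 : 0 < deriv Φ 0) (hd2 : 0 < iteratedDeriv 2 Φ 0) :
    ∃ C > (0 : ℝ), ∃ c > (0 : ℝ), ∃ T₀ > (0 : ℝ), ∀ t : ℝ, 0 < t → t ≤ T₀ →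
      c * t ^ 2 ≤ Ttrans Φ t ∧ Ttrans Φ t ≤ C * t ^ 2 := by
  obtain ⟨δ, hδ, hquad⟩ := exists_quadratic_bounds hC2 hd2
  have hdiff : DifferentiableAt ℝ Φ 0 := hC2.differentiable (by norm_num) 0
  set p := deriv Φ 0
  set D := iteratedDeriv 2 Φ 0
  refine ⟨p ^ 2 / D, by positivity, p ^ 2 / (4 * D), by positivity, min 1 (δ * D / (4 * p)),
    by positivity, fun t ht htT => ?_⟩
  have ht1 : t ≤ 1 := htT.trans (min_le_left _ _)
  have htδ : t * (4 * p) ≤ δ * D :=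
    (le_div_iff₀ (by positivity)).1 (htT.trans (min_le_right _ _))
  rw [Ttrans_eq hconv hdiff hd1.le ht.le ht1]
  constructor
  · have hu : |t * p / (2 * D)| ≤ δ := by
      rw [abs_of_pos (by positivity), div_le_iff₀ (by positivity)]
      nlinarith [mul_pos ht hd1, mul_pos hδ hd2]
    have hbdd : BddBelow (ftrans Φ t '' univ) := by
      refine ⟨0, forall_mem_image.2 fun u _ => ?_⟩
      exact add_nonneg (mul_nonneg (by linarith) (hnn _)) (mul_nonneg (by linarith) (hnn _))
    have hle := (csInf_le hbdd (mem_image_of_mem _ (mem_univ (t * p / (2 * D))))).trans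
      (ftrans_le_of_le_quadratic ht.le ht1 (hquad _ hu).2 (hquad _ (by rwa [abs_neg])).2)
    have hval : Φ 0 - t * p * (t * p / (2 * D)) + D * (t * p / (2 * D)) ^ 2 =
        Φ 0 - p ^ 2 / (4 * D) * t ^ 2 := by
      field_simp
      ring
    linarith
  · have hC : 0 ≤ p ^ 2 / D * t ^ 2 := by positivity
    have hlocal : ∀ u : ℝ, |u| ≤ δ → Φ 0 - t * p * u + D / 4 * u ^ 2 ≤ ftrans Φ t u :=
      fun u hu => le_ftrans_of_quadratic_le ht.le ht1 (hquad _ hu).1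
        (hquad _ (by rwa [abs_neg])).1
    suffices h : Φ 0 - p ^ 2 / D * t ^ 2 ≤ sInf (ftrans Φ t '' univ) by linarith
    refine le_csInf (univ_nonempty.image _) (forall_mem_image.2 fun u _ => ?_)
    rcases le_or_gt |u| δ with hu | hu
    · have hsq : 0 ≤ D / 4 * (u - 2 * t * p / D) ^ 2 := by positivity
      have hexp : D / 4 * (u - 2 * t * p / D) ^ 2 =
          D / 4 * u ^ 2 - t * p * u + p ^ 2 / D * t ^ 2 := by
        field_simp
        ring
      linarith [hlocal u hu]
    · suffices Φ 0 ≤ ftrans Φ t u by linarith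
      rcases lt_abs.1 hu with hu | hu
      · have hδ0 : ftrans Φ t 0 ≤ ftrans Φ t δ := by
          rw [ftrans_zero]
          have := hlocal δ (abs_of_pos hδ).le
          nlinarith
        have hmono := (convexOn_ftrans hconv ht.le ht1).le_right_of_left_le (mem_univ 0)
          (mem_univ u) (by rw [openSegment_eq_Ioo (hδ.trans hu)]; exact ⟨hδ, hu⟩) hδ0
        rw [ftrans_zero] at hδ0
        exact hδ0.trans hmono
      · exact le_ftrans_of_nonpos hconv hdiff hd1.le ht.le ht1 (by linarith)
end

section
/- Let F: ℝ × ℝ × ℝ → ℝ, with arguments written (t, a, τ), and let K ⊆ ℝ be a nonempty compact set. Assume that for each τ ∈ K, F is continuously differentiable on a neighborhood of (0, 0, τ), that F(0, 0, τ) = 0, and that the partial derivative ∂F/∂a(0, 0, τ) is nonzero. Then there exist ε > 0 and a function ā: ℝ × ℝ → ℝ such that ā(0, τ) = 0 for all τ ∈ K, ā is continuously differentiable on an open set containing (−ε, ε) × K, and F(t, ā(t, τ), τ) = 0 for all (t, τ) ∈ (−ε, ε) × K; moreover, after possibly shrinking ε, ā is the unique continuous function on (−ε, ε) × K with ā(0,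 τ) = 0 for all τ ∈ K satisfying F(t, ā(t, τ), τ) = 0 on (−ε, ε) × K. -/
open Set Filter Topology

theorem ContinuousLinearMap.isInvertible_of_apply_one_ne_zero {L : ℝ →L[ℝ] ℝ} (h : L 1 ≠ 0) :
    L.IsInvertible := by
  refine ⟨ContinuousLinearEquiv.unitsEquivAut ℝ (Units.mk0 (L 1) h), ?_⟩
  ext
  simp

section ImplicitOnCompact

variable {X : Type*} [NormedAddCommGroup X] [NormedSpace ℝ X] [CompleteSpace X]

/-- Local form: a `C¹` solution branch through a zero with nonvanishing partial derivative. -/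
theorem exists_local_implicit {G : X × ℝ → ℝ} {x₀ : X} (hG : ContDiffAt ℝ 1 G (x₀, 0))
    (h0 : G (x₀, 0) = 0) (hd : deriv (fun a => G (x₀, a)) 0 ≠ 0) :
    ∃ ψ : X → ℝ, ContDiffAt ℝ 1 ψ x₀ ∧ ψ x₀ = 0 ∧
      ∀ᶠ v in 𝓝 (x₀, (0 : ℝ)), G v = 0 ↔ ψ v.1 = v.2 := by
  have hinv : (fderiv ℝ G (x₀, 0) ∘L .inr ℝ X ℝ).IsInvertible := by
    apply ContinuousLinearMap.isInvertible_of_apply_one_ne_zero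
    have hG' : HasFDerivAt G (fderiv ℝ G (x₀, 0)) (x₀, 0) :=
      (hG.differentiableAt one_ne_zero).hasFDerivAt
    have hline : HasDerivAt (fun a : ℝ => (x₀, a)) ((0 : X), (1 : ℝ)) 0 :=
      (hasDerivAt_const _ _).prodMk (hasDerivAt_id _)
    have hcomp : HasDerivAt (fun a => G (x₀, a)) (fderiv ℝ G (x₀, 0) (0, 1)) 0 :=
      hG'.comp_hasDerivAt (0 : ℝ) hline
    rw [hcomp.deriv] at hd
    simpa using hd
  refine ⟨hG.implicitFunction one_ne_zero hinv, hG.contDiffAt_implicitFunction one_ne_zero hinv,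
    hG.implicitFunction_apply_self one_ne_zero hinv, ?_⟩
  simpa [h0] using hG.eventually_apply_eq_iff_implicitFunction one_ne_zero hinv

/-- The zeros near `S × {0}` are unique in a strip of uniform width. -/
theorem exists_uniform_unique_zero {G : X × ℝ → ℝ} {S : Set X} (hS : IsCompact S)
    (hG : ∀ x ∈ S, ContDiffAt ℝ 1 G (x, 0)) (h0 : ∀ x ∈ S, G (x, 0) = 0)
    (hd : ∀ x ∈ S, deriv (fun a => G (x, a)) 0 ≠ 0) :
    ∃ δ > (0 : ℝ), ∀ᶠ x in 𝓝ˢ S, ∀ a a' : ℝ, |a| < δ → |a'| < δ →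
      G (x, a) = 0 → G (x, a') = 0 → a = a' := by
  suffices h : ∃ δ > (0 : ℝ), ∀ x₀ ∈ S, ∀ᶠ x in 𝓝 x₀, ∀ a a' : ℝ, |a| < δ → |a'| < δ →
      G (x, a) = 0 → G (x, a') = 0 → a = a' by
    simpa only [eventually_nhdsSet_iff_forall] using h
  refine hS.induction_on (p := fun T => ∃ δ > (0 : ℝ), ∀ x₀ ∈ T, ∀ᶠ x in 𝓝 x₀,
    ∀ a a' : ℝ, |a| < δ → |a'| < δ → G (x, a) = 0 → G (x, a') = 0 → a = a') ?_ ?_ ?_ ?_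
  · exact ⟨1, one_pos, by simp⟩
  · rintro s t hst ⟨δ, hδ, h⟩
    exact ⟨δ, hδ, fun x hx => h x (hst hx)⟩
  · rintro s t ⟨δ, hδ, hs⟩ ⟨η, hη, ht⟩
    refine ⟨min δ η, lt_min hδ hη, ?_⟩
    rintro x (hx | hx)
    · filter_upwards [hs x hx] with y hy a a' ha ha'
      exact hy a a' (ha.trans_le (min_le_left _ _)) (ha'.trans_le (min_le_left _ _))
    · filter_upwards [ht x hx] with y hy a a' ha ha'
      exact hy a a' (ha.trans_le (min_le_right _ _)) (ha'.trans_le (min_le_right _ _))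
  · intro x hx
    obtain ⟨ψ, -, -, hψ⟩ := exists_local_implicit (hG x hx) (h0 x hx) (hd x hx)
    rw [nhds_prod_eq] at hψ
    obtain ⟨p, hp, q, hq, hpq⟩ := eventually_prod_iff.1 hψ
    obtain ⟨δ, hδ, hball⟩ := Metric.eventually_nhds_iff.1 hq
    refine ⟨{y | ∀ᶠ z in 𝓝 y, p z}, mem_nhdsWithin_of_mem_nhds (eventually_eventually_nhds.2 hp),
      δ, hδ, fun y hy => ?_⟩
    filter_upwards [hy] with z hz a a' ha ha' hGa hGa'
    have h₁ : ψ z = a := (hpq hz (hball (by simpa using ha))).1 hGa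
    have h₂ : ψ z = a' := (hpq hz (hball (by simpa using ha'))).1 hGa'
    exact h₁.symm.trans h₂

/-- Implicit function theorem along a compact set of base points. -/
theorem exists_implicit_on_compact {G : X × ℝ → ℝ} {S : Set X} (hS : IsCompact S)
    (hG : ∀ x ∈ S, ContDiffAt ℝ 1 G (x, 0)) (h0 : ∀ x ∈ S, G (x, 0) = 0)
    (hd : ∀ x ∈ S, deriv (fun a => G (x, a)) 0 ≠ 0) :
    ∃ δ > (0 : ℝ), ∃ g : X → ℝ, ∃ U : Set X, IsOpen U ∧ S ⊆ U ∧ ContDiffOn ℝ 1 g U ∧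
      (∀ x ∈ S, g x = 0) ∧
      ∀ x ∈ U, |g x| < δ ∧ G (x, g x) = 0 ∧ ∀ a, |a| < δ → G (x, a) = 0 → a = g x := by
  obtain ⟨δ, hδ, huniq⟩ := exists_uniform_unique_zero hS hG h0 hd
  rw [eventually_nhdsSet_iff_forall] at huniq
  classical
  let g : X → ℝ := fun x => if h : ∃ a, |a| < δ ∧ G (x, a) = 0 then h.choose else 0
  have hg : ∀ x, (∃ a, |a| < δ ∧ G (x, a) = 0) → |g x| < δ ∧ G (x, g x) = 0 := by
    intro x hx
    simp only [g, dif_pos hx]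
    exact hx.choose_spec
  have hloc : ∀ x ∈ S, g x = 0 ∧ ∀ᶠ y in 𝓝 x, ContDiffAt ℝ 1 g y ∧ |g y| < δ ∧ G (y, g y) = 0 ∧
      ∀ a, |a| < δ → G (y, a) = 0 → a = g y := by
    intro x hx
    obtain ⟨ψ, hψc, hψ0, hψ⟩ := exists_local_implicit (hG x hx) (h0 x hx) (hd x hx)
    have hsmall : ∀ᶠ y in 𝓝 x, |ψ y| < δ :=
      hψc.continuousAt.abs.eventually_lt_const (by simpa [hψ0] using hδ)
    have hzero : ∀ᶠ y in 𝓝 x, G (y, ψ y) = 0 := by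
      have ht : Tendsto (fun y => (y, ψ y)) (𝓝 x) (𝓝 (x, 0)) := by
        simpa [ContinuousAt, hψ0] using continuousAt_id.prodMk hψc.continuousAt
      filter_upwards [ht.eventually hψ] with y hy using hy.2 rfl
    have hgψ : g =ᶠ[𝓝 x] ψ := by
      filter_upwards [hsmall, hzero, huniq x hx] with y h₁ h₂ h₃
      have hy := hg y ⟨_, h₁, h₂⟩
      exact h₃ _ _ hy.1 h₁ hy.2 h₂
    refine ⟨hgψ.self_of_nhds.trans hψ0, ?_⟩
    filter_upwards [(hψc.congr_of_eventuallyEq hgψ).eventually (by simp), hsmall, hzero,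
      huniq x hx] with y hc h₁ h₂ h₃
    have hy := hg y ⟨_, h₁, h₂⟩
    exact ⟨hc, hy.1, hy.2, fun a ha hGa => h₃ _ _ ha hy.1 hGa hy.2⟩
  have hev := eventually_nhdsSet_iff_forall.2 fun x hx => (hloc x hx).2
  obtain ⟨U, hU, hSU, hUg⟩ := eventually_nhdsSet_iff_exists.1 hev
  exact ⟨δ, hδ, g, U, hU, hSU, fun x hx => (hUg x hx).1.contDiffWithinAt,
    fun x hx => (hloc x hx).1, fun x hx => (hUg x hx).2⟩

end ImplicitOnCompact

/-- Two continuous functions agreeing at a point of a preconnected set agree on the set, if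
the second stays in `(-δ, δ)` and the first equals the second wherever it takes a value in `(-δ, δ)`. -/
theorem IsPreconnected.eqOn_of_isolated {Y : Type*} [TopologicalSpace Y] {s : Set Y}
    (hs : IsPreconnected s) {f g : Y → ℝ} (hf : ContinuousOn f s) (hg : ContinuousOn g s) {δ : ℝ}
    (hgδ : ∀ y ∈ s, |g y| < δ) (hfg : ∀ y ∈ s, |f y| < δ → f y = g y) {y₀ : Y} (hy₀ : y₀ ∈ s)
    (h₀ : f y₀ = g y₀) : EqOn f g s := by
  have : PreconnectedSpace s := Subtype.preconnectedSpace hs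
  have hf' := continuousOn_iff_continuous_domRestrict.1 hf
  have hg' := continuousOn_iff_continuous_domRestrict.1 hg
  have hclosed : IsClosed {y : s | s.domRestrict f y = s.domRestrict g y} := isClosed_eq hf' hg'
  have heq : {y : s | s.domRestrict f y = s.domRestrict g y} =
      {y : s | |s.domRestrict f y| < δ} := by
    ext y
    refine ⟨fun h => ?_, hfg y y.2⟩
    simp only [mem_ofPred_eq] at h ⊢
    rw [h]
    exact hgδ y y.2
  have hopen : IsOpen {y : s | s.domRestrict f y = s.domRestrict g y} := by
    rw [heq]
    exact isOpen_lt hf'.abs continuous_const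
  have huniv := IsClopen.eq_univ ⟨hclosed, hopen⟩ ⟨⟨y₀, hy₀⟩, h₀⟩
  intro y hy
  have : (⟨y, hy⟩ : s) ∈ {y : s | s.domRestrict f y = s.domRestrict g y} := huniv ▸ mem_univ _
  exact this

theorem stmt2 (F : ℝ → ℝ → ℝ → ℝ) (K : Set ℝ) (hKne : K.Nonempty) (hK : IsCompact K)
    (hF : ∀ τ ∈ K,
      ContDiffAt ℝ 1 (fun q : ℝ × ℝ × ℝ => F q.1 q.2.1 q.2.2) ((0 : ℝ), (0 : ℝ), τ))
    (hF0 : ∀ τ ∈ K, F 0 0 τ = 0)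
    (hFa : ∀ τ ∈ K, deriv (fun a => F 0 a τ) 0 ≠ 0) :
    ∃ ε > (0 : ℝ), ∃ abar : ℝ → ℝ → ℝ,
      (∀ τ ∈ K, abar 0 τ = 0) ∧
      (∃ U : Set (ℝ × ℝ), IsOpen U ∧ (Set.Ioo (-ε) ε ×ˢ K) ⊆ U ∧
        ContDiffOn ℝ 1 (fun q : ℝ × ℝ => abar q.1 q.2) U) ∧
      (∀ t ∈ Set.Ioo (-ε) ε, ∀ τ ∈ K, F t (abar t τ) τ = 0) ∧
      ∃ ε' > (0 : ℝ), ε' ≤ ε ∧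
        ∀ b : ℝ → ℝ → ℝ,
          ContinuousOn (fun q : ℝ × ℝ => b q.1 q.2) (Set.Ioo (-ε') ε' ×ˢ K) →
          (∀ τ ∈ K, b 0 τ = 0) →
          (∀ t ∈ Set.Ioo (-ε') ε', ∀ τ ∈ K, F t (b t τ) τ = 0) →
          ∀ t ∈ Set.Ioo (-ε') ε', ∀ τ ∈ K, b t τ = abar t τ := by
  let G : (ℝ × ℝ) × ℝ → ℝ := fun v => F v.1.1 v.2 v.1.2
  have hS : IsCompact ({0} ×ˢ K : Set (ℝ × ℝ)) := isCompact_singleton.prod hK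
  obtain ⟨δ, hδ, g, U, hU, hSU, hgc, hg0, hgU⟩ :=
    exists_implicit_on_compact (G := G) hS
      (by
        rintro ⟨t, τ⟩ ⟨rfl, hτ⟩
        have hperm : ContDiffAt ℝ 1 (fun v : (ℝ × ℝ) × ℝ => (v.1.1, v.2, v.1.2)) ((0, τ), 0) := by
          fun_prop
        exact ContDiffAt.comp ((0, τ), (0 : ℝ)) (hF τ hτ) hperm)
      (by rintro ⟨t, τ⟩ ⟨rfl, hτ⟩; exact hF0 τ hτ)
      (by rintro ⟨t, τ⟩ ⟨rfl, hτ⟩; exact hFa τ hτ)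
  obtain ⟨u, v, hu, -, h0u, hKv, huv⟩ := generalized_tube_lemma isCompact_singleton hK hU hSU
  obtain ⟨ε, hε, hball⟩ := Metric.isOpen_iff.1 hu 0 (h0u rfl)
  have hsub : Ioo (-ε) ε ×ˢ K ⊆ U := by
    rintro ⟨t, τ⟩ ⟨ht, hτ⟩
    exact huv ⟨hball (by simpa [abs_lt] using ht), hKv hτ⟩
  refine ⟨ε, hε, fun t τ => g (t, τ), fun τ hτ => hg0 _ ⟨rfl, hτ⟩, ⟨U, hU, hsub, hgc⟩,
    fun t ht τ hτ => (hgU (t, τ) (hsub ⟨ht, hτ⟩)).2.1, ε, hε, le_rfl,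
    fun b hb hb0 hbF t ht τ hτ => ?_⟩
  have hslice : MapsTo (fun s : ℝ => (s, τ)) (Ioo (-ε) ε) (Ioo (-ε) ε ×ˢ K) := fun s hs => ⟨hs, hτ⟩
  have hcont : ContinuousOn (fun s : ℝ => (s, τ)) (Ioo (-ε) ε) := by fun_prop
  exact isPreconnected_Ioo.eqOn_of_isolated (f := fun s => b s τ) (g := fun s => g (s, τ))
    (hb.comp hcont hslice) ((hgc.continuousOn.mono hsub).comp hcont hslice)
    (fun s hs => (hgU (s, τ) (hsub ⟨hs, hτ⟩)).1)
    (fun s hs hbs => (hgU (s, τ) (hsub ⟨hs, hτ⟩)).2.2 _ hbs (hbF s hs τ hτ))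
    (show (0 : ℝ) ∈ Ioo (-ε) ε by simpa using hε)
    ((hb0 τ hτ).trans (hg0 (0, τ) ⟨rfl, hτ⟩).symm) ht
end

section
/- Fix an integer n ≥ 2. Assume Φ: ℝ → ℝ is nonnegative, nonincreasing, convex, twice continuously differentiable, and satisfies Φ′(u) < 0 and Φ″(u) > 0 for every u ∈ (0, 1/2]. Then T(t) = Θ(t²) near zero: there exist positive constants C > 0, c > 0 and t₁ > 0 such that for all t with 0 < t ≤ t₁, c·t² ≤ T(t) ≤ C·t². -/
open Set

/-- The `H`-estimation error transformation for comp-sum losses: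
`T(t) = inf_{τ ∈ [1/n, 1/2]} sup_{|u| ≤ τ} (Φ(τ) - ((1-t)/2)Φ(τ+u) - ((1+t)/2)Φ(τ-u))`. -/
noncomputable def Tcomp (n : ℕ) (Φ : ℝ → ℝ) (t : ℝ) : ℝ :=
  sInf ((fun τ => sSup ((fun u =>
      Φ τ - ((1 - t) / 2) * Φ (τ + u) - ((1 + t) / 2) * Φ (τ - u)) '' Set.Icc (-τ) τ)) ''
    Set.Icc (1 / (n : ℝ)) (1 / 2))

/-- A lower bound `c` on the second derivative bounds symmetric second differences from below. -/
theorem add_mul_sq_le_of_le_iteratedDeriv_two {f : ℝ → ℝ} (hf : ContDiff ℝ 2 f) {a b c x u : ℝ}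
    (hc : ∀ y ∈ Icc a b, c ≤ iteratedDeriv 2 f y)
    (hadd : x + u ∈ Icc a b) (hsub : x - u ∈ Icc a b) :
    2 * f x + c * u ^ 2 ≤ f (x + u) + f (x - u) := by
  have hq : ContDiff ℝ 2 fun y : ℝ => c / 2 * y ^ 2 := by fun_prop
  have hq' : ∀ y, iteratedDeriv 2 (fun y : ℝ => c / 2 * y ^ 2) y = c := fun y => by
    have h1 : deriv (fun y : ℝ => c / 2 * y ^ 2) = fun y => c * y := by
      ext z
      simp
      ring
    rw [iteratedDeriv_succ, iteratedDeriv_one, h1]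
    simp
  have hconv : ConvexOn ℝ (Icc a b) (f - fun y => c / 2 * y ^ 2) := by
    have hd : ContDiff ℝ 2 (f - fun y => c / 2 * y ^ 2) := hf.sub hq
    refine convexOn_of_deriv2_nonneg (convex_Icc a b) hd.continuous.continuousOn
      (hd.differentiable (by norm_num)).differentiableOn ?_ fun y hy => ?_
    · have : ContDiff ℝ 1 (deriv (f - fun y => c / 2 * y ^ 2)) := hd.deriv' (n := 1)
      exact (this.differentiable (by norm_num)).differentiableOn
    · rw [← iteratedDeriv_eq_iterate, iteratedDeriv_sub hf.contDiffAt hq.contDiffAt, hq']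
      exact sub_nonneg.2 (hc y (interior_subset hy))
  have h := hconv.2 hadd hsub (by norm_num : (0 : ℝ) ≤ 1 / 2) (by norm_num : (0 : ℝ) ≤ 1 / 2)
    (by norm_num)
  have hx : (1 / 2 : ℝ) • (x + u) + (1 / 2 : ℝ) • (x - u) = x := by
    simp only [smul_eq_mul]; ring
  rw [hx] at h
  simp only [Pi.sub_apply, smul_eq_mul] at h
  linarith

theorem ConvexOn.sub_mul_deriv_le {f : ℝ → ℝ} (hf : ConvexOn ℝ univ f) (hd : Differentiable ℝ f)
    {x y s : ℝ} (hxy : x ≤ y) (hs : 0 < s) : f x - s * deriv f y ≤ f (x - s) := by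
  have h1 : deriv f x ≤ deriv f y :=
    hf.monotoneOn_deriv (fun z _ => hd z) (mem_univ x) (mem_univ y) hxy
  have h2 := hf.slope_le_deriv (mem_univ (x - s)) (mem_univ x) (by linarith) (hd x)
  rw [slope_def_field, div_le_iff₀ (by linarith)] at h2
  nlinarith

/-- A convex function that is strongly convex near `1 / 2` has quadratically growing symmetric
second differences there. -/
theorem ConvexOn.exists_mul_sq_le {f : ℝ → ℝ} (hf : ConvexOn ℝ univ f) (hC2 : ContDiff ℝ 2 f)
    (hpos : 0 < iteratedDeriv 2 f (1 / 2)) :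
    ∃ k > 0, ∀ u ∈ Icc (-(1 / 2) : ℝ) (1 / 2),
      2 * f (1 / 2) + k * u ^ 2 ≤ f (1 / 2 + u) + f (1 / 2 - u) := by
  set μ := iteratedDeriv 2 f (1 / 2) / 2 with hμ
  have hcont : Continuous (iteratedDeriv 2 f) := hC2.continuous_iteratedDeriv 2 le_rfl
  have hnear : ∀ᶠ y in nhds (1 / 2 : ℝ), μ < iteratedDeriv 2 f y :=
    hcont.continuousAt.eventually (lt_mem_nhds (by linarith))
  obtain ⟨ε, hε, hball⟩ := Metric.eventually_nhds_iff.1 hnear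
  obtain ⟨d, hd0, hdε, hd1⟩ : ∃ d : ℝ, 0 < d ∧ d < ε ∧ d ≤ 1 :=
    ⟨min (ε / 2) 1, by positivity, by linarith [min_le_left (ε / 2) 1], min_le_right _ _⟩
  refine ⟨μ * d, by positivity, fun u hu => ?_⟩
  have hmem : ∀ v ∈ Icc (-(1 / 2) : ℝ) (1 / 2),
      1 / 2 + d * v ∈ Icc (1 / 2 - d) (1 / 2 + d) ∧
        1 / 2 - d * v ∈ Icc (1 / 2 - d) (1 / 2 + d) := fun v hv => by
    obtain ⟨h1, h2⟩ := hv
    refine ⟨⟨?_, ?_⟩, ?_, ?_⟩ <;> nlinarith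
  have hstrong : 2 * f (1 / 2) + μ * (d * u) ^ 2 ≤ f (1 / 2 + d * u) + f (1 / 2 - d * u) := by
    refine add_mul_sq_le_of_le_iteratedDeriv_two hC2 (a := 1 / 2 - d) (b := 1 / 2 + d)
      (fun y hy => (hball ?_).le) (hmem u hu).1 (hmem u hu).2
    rw [Real.dist_eq, abs_lt]
    exact ⟨by linarith [hy.1], by linarith [hy.2]⟩
  have hscale : ∀ v, f (1 / 2 + d * v) ≤ (1 - d) * f (1 / 2) + d * f (1 / 2 + v) := fun v => by
    have h := hf.2 (mem_univ (1 / 2)) (mem_univ (1 / 2 + v))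
      (by linarith : 0 ≤ 1 - d) hd0.le (by ring)
    simp only [smul_eq_mul] at h
    rwa [show (1 - d) * (1 / 2) + d * (1 / 2 + v) = 1 / 2 + d * v by ring] at h
  have h1 := hscale u
  have h2 := hscale (-u)
  rw [mul_neg, ← sub_eq_add_neg, ← sub_eq_add_neg] at h2
  refine le_of_mul_le_mul_left ?_ hd0
  linarith

theorem stmt3 (n : ℕ) (hn : 2 ≤ n) (Φ : ℝ → ℝ)
    (hnn : ∀ x, 0 ≤ Φ x) (hanti : Antitone Φ) (hconv : ConvexOn ℝ Set.univ Φ)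
    (hC2 : ContDiff ℝ 2 Φ)
    (hd1 : ∀ u ∈ Set.Ioc (0 : ℝ) (1 / 2), deriv Φ u < 0)
    (hd2 : ∀ u ∈ Set.Ioc (0 : ℝ) (1 / 2), 0 < iteratedDeriv 2 Φ u) :
    ∃ C > (0 : ℝ), ∃ c > (0 : ℝ), ∃ t₁ > (0 : ℝ), ∀ t : ℝ, 0 < t → t ≤ t₁ →
      c * t ^ 2 ≤ Tcomp n Φ t ∧ Tcomp n Φ t ≤ C * t ^ 2 := by
  have hdiff : Differentiable ℝ Φ := hC2.differentiable (by norm_num)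
  have hcont : Continuous Φ := hC2.continuous
  have hn0 : (0 : ℝ) < 1 / n := by positivity
  have hn2 : (1 / n : ℝ) ≤ 1 / 2 :=
    one_div_le_one_div_of_le (by norm_num) (by exact_mod_cast hn)
  have hhalf : (1 / 2 : ℝ) ∈ Ioc (0 : ℝ) (1 / 2) := by norm_num
  obtain ⟨k, hk, hquad⟩ := hconv.exists_mul_sq_le hC2 (hd2 _ hhalf)
  obtain ⟨m, hm, hm0⟩ : ∃ m, deriv Φ (1 / 2) = -m ∧ 0 < m :=
    ⟨-deriv Φ (1 / 2), by ring, by linarith [hd1 _ hhalf]⟩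
  obtain ⟨M, hM0, hM⟩ : ∃ M > 0, ∀ y ∈ Icc (0 : ℝ) 1, iteratedDeriv 2 Φ y ≤ M := by
    obtain ⟨M, hM⟩ := isCompact_Icc.bddAbove_image (K := Icc (0 : ℝ) 1)
      (hC2.continuous_iteratedDeriv 2 le_rfl).continuousOn
    exact ⟨max M 1, by positivity, fun y hy =>
      (hM (mem_image_of_mem _ hy)).trans (le_max_left _ _)⟩
  obtain ⟨L, hL0, hL⟩ : ∃ L > 0, ∀ y ∈ Icc (0 : ℝ) 1, ‖deriv Φ y‖ ≤ L := by
    obtain ⟨L, hL⟩ := isCompact_Icc.exists_bound_of_continuousOn (s := Icc (0 : ℝ) 1)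
      (hC2.continuous_deriv (by norm_num)).continuousOn
    exact ⟨max L 1, by positivity, fun y hy => (hL y hy).trans (le_max_left _ _)⟩
  have hbdd : ∀ t τ, BddAbove ((fun u =>
      Φ τ - ((1 - t) / 2) * Φ (τ + u) - ((1 + t) / 2) * Φ (τ - u)) '' Icc (-τ) τ) := fun t τ =>
    isCompact_Icc.bddAbove_image (by fun_prop)
  have hlower : ∀ t, 0 < t → t ≤ 2 * M / (m * n) → ∀ τ ∈ Icc (1 / (n : ℝ)) (1 / 2),
      m ^ 2 / (8 * M) * t ^ 2 ≤ sSup ((fun u =>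
        Φ τ - ((1 - t) / 2) * Φ (τ + u) - ((1 + t) / 2) * Φ (τ - u)) '' Icc (-τ) τ) := by
    intro t ht ht1 τ hτ
    obtain ⟨s, hs⟩ : ∃ s, s = t * m / (2 * M) := ⟨_, rfl⟩
    have hs0 : 0 < s := by rw [hs]; positivity
    have hsn : s ≤ 1 / n := by
      calc s ≤ 2 * M / (m * n) * m / (2 * M) := by rw [hs]; gcongr
        _ = 1 / n := by field_simp
    have hsτ := hsn.trans hτ.1
    have hτ2 := hτ.2
    refine le_csSup_of_le (hbdd t τ) ⟨-s, ⟨by linarith, by linarith⟩, rfl⟩ ?_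
    have hsecond := add_mul_sq_le_of_le_iteratedDeriv_two (f := -Φ) hC2.neg (a := 0) (b := 1) (c := -M)
      (x := τ) (u := s)
      (fun y hy => by rw [iteratedDeriv_neg]; exact neg_le_neg (hM y hy))
      ⟨by linarith, by linarith⟩ ⟨by linarith, by linarith⟩
    have hfirst := hconv.sub_mul_deriv_le hdiff hτ2 hs0
    have hmono : Φ (τ + s) ≤ Φ τ := hanti (by linarith)
    have hmul : t * (s * m) ≤ t * (Φ (τ - s) - Φ (τ + s)) :=
      mul_le_mul_of_nonneg_left (by rw [hm] at hfirst; linarith) ht.le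
    have hval : m ^ 2 / (8 * M) * t ^ 2 = t * (s * m) / 2 - M * s ^ 2 / 2 := by
      rw [hs]; field_simp; ring
    simp only [Pi.neg_apply] at hsecond
    simp only [sub_neg_eq_add, ← sub_eq_add_neg]
    linarith
  refine ⟨L ^ 2 / (2 * k), by positivity, m ^ 2 / (8 * M), by positivity, 2 * M / (m * n),
    by have : (0 : ℝ) < n := one_div_pos.1 hn0
       positivity, fun t ht ht1 => ⟨?_, ?_⟩⟩
  · refine le_csInf ((nonempty_Icc.2 hn2).image _) ?_
    rintro _ ⟨τ, hτ, rfl⟩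
    exact hlower t ht ht1 τ hτ
  · refine csInf_le_of_le ⟨m ^ 2 / (8 * M) * t ^ 2, ?_⟩
      (mem_image_of_mem _ (right_mem_Icc.2 hn2)) ?_
    · rintro _ ⟨τ, hτ, rfl⟩
      exact hlower t ht ht1 τ hτ
    refine csSup_le ((nonempty_Icc.2 (by norm_num)).image _) ?_
    rintro _ ⟨u, hu, rfl⟩
    have hlip := (convex_Icc (0 : ℝ) 1).norm_image_sub_le_of_norm_deriv_le (f := Φ)
      (fun y _ => hdiff y) hL (x := 1 / 2 - u) (y := 1 / 2 + u)
      ⟨by linarith [hu.2], by linarith [hu.1]⟩ ⟨by linarith [hu.1], by linarith [hu.2]⟩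
    have hdist : ‖(1 / 2 + u) - (1 / 2 - u)‖ = 2 * |u| := by
      rw [Real.norm_eq_abs, show (1 / 2 + u) - (1 / 2 - u) = 2 * u by ring, abs_mul, abs_two]
    rw [hdist] at hlip
    have hmul := mul_le_mul_of_nonneg_left ((le_abs_self _).trans hlip) ht.le
    have hsq := hquad u hu
    have hamgm : t * L * |u| - k / 2 * |u| ^ 2 ≤ L ^ 2 / (2 * k) * t ^ 2 := by
      have : L ^ 2 / (2 * k) * t ^ 2 - (t * L * |u| - k / 2 * |u| ^ 2)
          = (L * t - k * |u|) ^ 2 / (2 * k) := by field_simp; ring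
      have h0 : 0 ≤ (L * t - k * |u|) ^ 2 / (2 * k) := by positivity
      linarith
    rw [sq_abs] at hamgm
    dsimp only
    linarith
end

section
/- Assume Φ: ℝ → ℝ is nonnegative, nondecreasing, convex, twice continuously differentiable, and satisfies Φ′(u) > 0 and Φ″(u) > 0 for every u ≥ 0. Then for any A > 0, the function U(t) = inf over τ ∈ [0, A] of ( sup over u ∈ ℝ of ( Φ(τ) − ((1−t)/2)·Φ(τ+u) − ((1+t)/2)·Φ(τ−u) ) ) satisfies U(t) = Θ(t²) near zero: there exist positive constants C > 0, c > 0 and t₁ > 0 such that for all t with 0 < t ≤ t₁, c·t² ≤ U(t) ≤ C·t². -/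
open Set

/-- The quantity
`U(t) = inf_{τ ∈ [0, A]} sup_{u ∈ ℝ} (Φ(τ) - ((1-t)/2)Φ(τ+u) - ((1+t)/2)Φ(τ-u))`
associated with constrained losses. -/
noncomputable def Ucstnd (Φ : ℝ → ℝ) (A t : ℝ) : ℝ :=
  sInf ((fun τ => sSup (Set.range fun u : ℝ =>
      Φ τ - ((1 - t) / 2) * Φ (τ + u) - ((1 + t) / 2) * Φ (τ - u))) '' Set.Icc 0 A)

/-- A lower bound `m` on the second derivative bounds symmetric second differences below. -/
theorem le_second_difference_of_le_iteratedDeriv {f : ℝ → ℝ} (hf : ContDiff ℝ 2 f) {a b m : ℝ}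
    (hm : ∀ x ∈ Icc a b, m ≤ iteratedDeriv 2 f x) {x u : ℝ} (h₁ : x + u ∈ Icc a b)
    (h₂ : x - u ∈ Icc a b) : m * u ^ 2 ≤ f (x + u) + f (x - u) - 2 * f x := by
  have hfd : Differentiable ℝ f := hf.differentiable (by norm_num)
  have hfd' : Differentiable ℝ (deriv f) := by
    have := hf.differentiable_iteratedDeriv 1 (by norm_num)
    rwa [iteratedDeriv_one] at this
  have hg (y : ℝ) : HasDerivAt (fun y => f y - m / 2 * y ^ 2) (deriv f y - m * y) y := by
    have := (hfd y).hasDerivAt.sub (((hasDerivAt_id y).pow 2).const_mul (m / 2))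
    refine this.congr_deriv ?_
    simp
    ring
  have hg' (y : ℝ) : HasDerivAt (fun y => deriv f y - m * y) (iteratedDeriv 2 f y - m) y := by
    have := (hfd' y).hasDerivAt.sub ((hasDerivAt_id y).const_mul m)
    refine this.congr_deriv ?_
    simp [iteratedDeriv_eq_iterate]
  have hderiv : deriv (fun y => f y - m / 2 * y ^ 2) = fun y => deriv f y - m * y :=
    funext fun y => (hg y).deriv
  have hconv : ConvexOn ℝ (Icc a b) fun y => f y - m / 2 * y ^ 2 := by
    refine convexOn_of_deriv2_nonneg' (convex_Icc a b)
      (fun y _ => (hg y).differentiableAt.differentiableWithinAt) ?_ fun y hy => ?_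
    · rw [hderiv]
      exact fun y _ => (hg' y).differentiableAt.differentiableWithinAt
    · simp only [Function.iterate_succ, Function.iterate_zero, Function.comp_apply, id_eq]
      rw [hderiv, (hg' y).deriv]
      exact sub_nonneg.2 (hm y hy)
  have h := hconv.2 h₁ h₂ (by norm_num : (0 : ℝ) ≤ 1 / 2) (by norm_num : (0 : ℝ) ≤ 1 / 2)
    (by norm_num)
  have hx : (1 / 2 : ℝ) • (x + u) + (1 / 2 : ℝ) • (x - u) = x := by
    simp only [smul_eq_mul]
    ring
  rw [hx] at h
  simp only [smul_eq_mul] at h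
  nlinarith

/-- An upper bound `M` on the second derivative bounds symmetric second differences above. -/
theorem second_difference_le_of_iteratedDeriv_le {f : ℝ → ℝ} (hf : ContDiff ℝ 2 f) {a b M : ℝ}
    (hM : ∀ x ∈ Icc a b, iteratedDeriv 2 f x ≤ M) {x u : ℝ} (h₁ : x + u ∈ Icc a b)
    (h₂ : x - u ∈ Icc a b) : f (x + u) + f (x - u) - 2 * f x ≤ M * u ^ 2 := by
  have h := le_second_difference_of_le_iteratedDeriv (f := -f) hf.neg (m := -M)
    (fun y hy => by
      rw [iteratedDeriv_neg]
      exact neg_le_neg (hM y hy)) h₁ h₂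
  simp only [Pi.neg_apply] at h
  linarith

/-- A differentiable convex function lies above its tangent lines. -/
theorem ConvexOn.tangent_le {f : ℝ → ℝ} (hf : ConvexOn ℝ univ f) (hd : Differentiable ℝ f)
    (x y : ℝ) : f x + deriv f x * (y - x) ≤ f y := by
  rcases lt_trichotomy x y with h | rfl | h
  · have := hf.le_slope_of_hasDerivAt (mem_univ x) (mem_univ y) h (hd x).hasDerivAt
    rw [slope_def_field, le_div_iff₀ (sub_pos.2 h)] at this
    linarith
  · simp
  · have := hf.slope_le_of_hasDerivAt (mem_univ y) (mem_univ x) h (hd x).hasDerivAt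
    rw [slope_def_field, div_le_iff₀ (sub_pos.2 h)] at this
    linarith

/-- Symmetric second differences of a convex function grow at least linearly. -/
theorem ConvexOn.mul_second_difference_le {f : ℝ → ℝ} (hf : ConvexOn ℝ univ f) (x : ℝ) {r u : ℝ}
    (hr : 0 < r) (hu : r ≤ u) :
    u * (f (x + r) + f (x - r) - 2 * f x) ≤ r * (f (x + u) + f (x - u) - 2 * f x) := by
  have hu0 : 0 < u := hr.trans_le hu
  have key (s : ℝ) : u * f (x + r * s) ≤ r * f (x + u * s) + (u - r) * f x := by
    have h := hf.2 (mem_univ (x + u * s)) (mem_univ x) (div_nonneg hr.le hu0.le)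
      (sub_nonneg.2 ((div_le_one hu0).2 hu)) (by ring)
    have hx : (r / u) • (x + u * s) + (1 - r / u) • x = x + r * s := by
      simp only [smul_eq_mul]
      field_simp
      ring
    rw [hx] at h
    have h' := mul_le_mul_of_nonneg_left h hu0.le
    refine h'.trans (le_of_eq ?_)
    simp only [smul_eq_mul]
    field_simp
  have h₁ := key 1
  have h₂ := key (-1)
  simp only [mul_one, mul_neg, ← sub_eq_add_neg] at h₁ h₂
  linarith

theorem stmt4 (Φ : ℝ → ℝ) (hnn : ∀ x, 0 ≤ Φ x) (hmono : Monotone Φ)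
    (hconv : ConvexOn ℝ Set.univ Φ) (hC2 : ContDiff ℝ 2 Φ)
    (hd1 : ∀ u : ℝ, 0 ≤ u → 0 < deriv Φ u)
    (hd2 : ∀ u : ℝ, 0 ≤ u → 0 < iteratedDeriv 2 Φ u)
    (A : ℝ) (hA : 0 < A) :
    ∃ C > (0 : ℝ), ∃ c > (0 : ℝ), ∃ t₁ > (0 : ℝ), ∀ t : ℝ, 0 < t → t ≤ t₁ →
      c * t ^ 2 ≤ Ucstnd Φ A t ∧ Ucstnd Φ A t ≤ C * t ^ 2 := by
  have hdiff : Differentiable ℝ Φ := hC2.differentiable (by norm_num)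
  have hcont : Continuous (iteratedDeriv 2 Φ) := hC2.continuous_iteratedDeriv' 2
  obtain ⟨m, hm0, hm⟩ : ∃ m > 0, ∀ x ∈ Icc 0 (2 * A), m ≤ iteratedDeriv 2 Φ x := by
    obtain ⟨z, hz, hmin⟩ := (isCompact_Icc (a := 0) (b := 2 * A)).exists_isMinOn
      (nonempty_Icc.2 (by positivity)) hcont.continuousOn
    exact ⟨_, hd2 z hz.1, fun x hx => hmin hx⟩
  set p := deriv Φ 0 with hp
  have hp0 : 0 < p := hd1 0 le_rfl
  obtain ⟨M, hpM, hM⟩ : ∃ M, p ≤ M ∧ ∀ x ∈ Icc (-1) (A + 1), iteratedDeriv 2 Φ x ≤ M := by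
    obtain ⟨z, -, hmax⟩ := (isCompact_Icc (a := -1) (b := A + 1)).exists_isMaxOn
      (nonempty_Icc.2 (by linarith)) hcont.continuousOn
    exact ⟨max p (iteratedDeriv 2 Φ z), le_max_left _ _,
      fun x hx => (hmax hx).trans (le_max_right _ _)⟩
  have hM0 : 0 < M := hp0.trans_le hpM
  set P := deriv Φ A with hP
  have hP0 : 0 < P := hd1 A hA.le
  have hbdd {t : ℝ} (ht0 : 0 < t) (ht1 : t ≤ 1) (τ : ℝ) : BddAbove (range fun u : ℝ =>
      Φ τ - ((1 - t) / 2) * Φ (τ + u) - ((1 + t) / 2) * Φ (τ - u)) := by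
    refine ⟨Φ τ, ?_⟩
    rintro _ ⟨u, rfl⟩
    have h₁ := mul_nonneg (by linarith : 0 ≤ (1 - t) / 2) (hnn (τ + u))
    have h₂ := mul_nonneg (by linarith : 0 ≤ (1 + t) / 2) (hnn (τ - u))
    simp only
    linarith
  refine ⟨P ^ 2 / m, by positivity, p ^ 2 / (8 * M), by positivity,
    min (1 / 2) (m * A / (4 * P)), by positivity, fun t ht0 ht => ⟨?_, ?_⟩⟩
  · have ht1 : t ≤ 1 / 2 := ht.trans (min_le_left _ _)
    refine le_csInf ((nonempty_Icc.2 hA.le).image _) ?_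
    rintro _ ⟨τ, hτ, rfl⟩
    set u := p / (2 * M) * t with hu
    have hu0 : 0 ≤ u := by positivity
    have hu1 : u ≤ 1 := by
      have : p / (2 * M) ≤ 1 := (div_le_one (by positivity)).2 (by linarith)
      nlinarith
    refine le_trans ?_ (le_csSup (hbdd ht0 (by linarith) τ) ⟨u, rfl⟩)
    have hE := second_difference_le_of_iteratedDeriv_le hC2 hM (x := τ) (u := u)
      ⟨by linarith [hτ.1], by linarith [hτ.2]⟩ ⟨by linarith [hτ.1], by linarith [hτ.2]⟩
    have htan := hconv.tangent_le hdiff τ (τ + u)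
    have hpτ : p ≤ deriv Φ τ :=
      hconv.monotoneOn_deriv (fun x _ => hdiff x) (mem_univ 0) (mem_univ τ) hτ.1
    have hlow : Φ (τ - u) ≤ Φ τ := hmono (by linarith)
    have hslope : p * u ≤ Φ (τ + u) - Φ (τ - u) := by
      have := mul_le_mul_of_nonneg_right hpτ hu0
      rw [add_sub_cancel_left] at htan
      linarith
    have hprod := mul_le_mul_of_nonneg_left hslope ht0.le
    have hval : p ^ 2 / (8 * M) * t ^ 2 = t * (p * u) / 2 - M * u ^ 2 / 2 := by
      rw [hu]
      field_simp
      ring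
    simp only
    rw [hval]
    linarith
  · have ht1 : t ≤ 1 / 2 := ht.trans (min_le_left _ _)
    have ht2 : t * (4 * P) ≤ m * A :=
      (le_div_iff₀ (by positivity)).1 (ht.trans (min_le_right _ _))
    refine (csInf_le ⟨0, ?_⟩ (mem_image_of_mem _ (right_mem_Icc.2 hA.le))).trans
      (csSup_le (range_nonempty _) ?_)
    · rintro _ ⟨τ, -, rfl⟩
      refine le_csSup (hbdd ht0 (by linarith) τ) ⟨0, ?_⟩
      simp only [add_zero, sub_zero]
      ring
    rintro _ ⟨u, rfl⟩
    have h₁ := hconv.tangent_le hdiff A (A + u)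
    have h₂ := hconv.tangent_le hdiff A (A - u)
    rw [← hP] at h₁ h₂
    have hg : Φ A - ((1 - t) / 2) * Φ (A + u) - ((1 + t) / 2) * Φ (A - u) ≤
        t * P * |u| - (Φ (A + |u|) + Φ (A - |u|) - 2 * Φ A) / 4 := by
      have heven : Φ (A + |u|) + Φ (A - |u|) = Φ (A + u) + Φ (A - u) := by
        rcases abs_choice u with h | h <;> rw [h]
        rw [sub_neg_eq_add, ← sub_eq_add_neg, add_comm]
      have habs : t * P * u ≤ t * P * |u| :=
        mul_le_mul_of_nonneg_left (le_abs_self u) (by positivity)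
      have k₁ := mul_le_mul_of_nonneg_left h₁ (by linarith : 0 ≤ (1 - t) / 2 - 1 / 4)
      have k₂ := mul_le_mul_of_nonneg_left h₂ (by linarith : 0 ≤ (1 + t) / 2 - 1 / 4)
      rw [heven]
      linarith
    refine hg.trans ?_
    have hv0 := abs_nonneg u
    generalize |u| = v at hv0
    have hquad {w : ℝ} (hw0 : 0 ≤ w) (hwA : w ≤ A) :
        m * w ^ 2 ≤ Φ (A + w) + Φ (A - w) - 2 * Φ A :=
      le_second_difference_of_le_iteratedDeriv hC2 hm
        ⟨by linarith, by linarith⟩ ⟨by linarith, by linarith⟩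
    rcases le_total v A with hv | hv
    · have hsq : P ^ 2 / m * t ^ 2 - (t * P * v - m * v ^ 2 / 4) =
          (P * t - m * v / 2) ^ 2 / m := by
        field_simp
        ring
      have : 0 ≤ (P * t - m * v / 2) ^ 2 / m := by positivity
      linarith [hquad hv0 hv]
    · have hlin : m * A * v ≤ Φ (A + v) + Φ (A - v) - 2 * Φ A := by
        have := mul_le_mul_of_nonneg_left (hquad hA.le le_rfl) hv0
        have := hconv.mul_second_difference_le A hA hv
        refine le_of_mul_le_mul_left ?_ hA
        linarith
      have hneg := mul_le_mul_of_nonneg_right ht2 hv0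
      have : 0 ≤ P ^ 2 / m * t ^ 2 := by positivity
      linarith
end

section
/- Let X be a standard Borel space, μ a probability measure on X, n ≥ 1, Y = {1, …, n}, and let ℓ̂: ℝⁿ × Y → [0, ∞) be a measurable function and p: X → ℝⁿ a measurable map taking values in the probability simplex (p(x)_y ≥ 0 and Σ_y p(x)_y = 1). Then: (i) the function x ↦ inf over α ∈ ℝⁿ of Σ_{y ∈ Y} p(x)_y · ℓ̂(α, y) is measurable; and (ii) the Bayes error equals the expectation of the pointwise Bayes conditional error, i.e. the infimum over all measurable functions h: X → ℝⁿ of ∫ Σ_{y ∈ Y} p(x)_y · ℓ̂(h(x), y) dμ(x) equals ∫ ( inf over α ∈ ℝⁿ of Σ_{y ∈ Y} p(x)_y · ℓ̂(α, y) ) dμ(x), where integrals are Lebesgue integrals of nonnegative (possibly infinite) functions. -/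
open MeasureTheory

/-- A function into a second-countable space has a sequence of arguments whose values meet every
open set met by the function. -/
theorem exists_seq_forall_isOpen_exists_mem {A E : Type*} [Nonempty A] [TopologicalSpace E]
    [SecondCountableTopology E] (f : A → E) :
    ∃ u : ℕ → A, ∀ U : Set E, IsOpen U → ∀ a, f a ∈ U → ∃ k, f (u k) ∈ U := by
  choose g hg using fun s : Set.range f => s.2
  refine ⟨fun k => g (TopologicalSpace.denseSeq (Set.range f) k), fun U hU a ha => ?_⟩
  obtain ⟨k, hk⟩ := (TopologicalSpace.denseRange_denseSeq (Set.range f)).exists_mem_open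
    (hU.preimage continuous_subtype_val) ⟨⟨f a, a, rfl⟩, ha⟩
  exact ⟨k, by rw [hg]; exact hk⟩

/-- The lower envelope of a family of real functions, nonnegative and approximated from above by a
sequence of measurable members, is measurable and has measurable near-minimizers. -/
theorem measurable_iInf_and_exists_measurable_lt_add {X A : Type*} [MeasurableSpace X]
    [MeasurableSpace A] [Nonempty A] (F : X → A → ℝ) (hF : ∀ x a, 0 ≤ F x a) (u : ℕ → A)
    (hu : ∀ k, Measurable fun x => F x (u k))
    (hdense : ∀ x a c, F x a < c → ∃ k, F x (u k) < c) :
    Measurable (fun x => ⨅ a, F x a) ∧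
      ∀ ε > 0, ∃ h : X → A, Measurable h ∧ ∀ x, F x (h x) < (⨅ a, F x a) + ε := by
  classical
  have hbdd : ∀ x, BddBelow (Set.range (F x)) := fun x => ⟨0, by rintro _ ⟨a, rfl⟩; exact hF x a⟩
  have hseq : ∀ x, ∀ ε > 0, ∃ k, F x (u k) < (⨅ a, F x a) + ε := fun x ε hε => by
    obtain ⟨a, ha⟩ := exists_lt_of_ciInf_lt (lt_add_of_pos_right (⨅ a, F x a) hε)
    exact hdense x a _ ha
  have heq : (fun x => ⨅ a, F x a) = fun x => ⨅ k, F x (u k) := by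
    funext x
    refine le_antisymm (le_ciInf fun k => ciInf_le (hbdd x) _)
      (le_of_forall_pos_le_add fun ε hε => ?_)
    obtain ⟨k, hk⟩ := hseq x ε hε
    exact (ciInf_le ((hbdd x).mono (Set.range_comp_subset_range u (F x))) k).trans hk.le
  have hmeas : Measurable (fun x => ⨅ a, F x a) := by
    rw [heq]
    exact Measurable.iInf hu
  refine ⟨hmeas, fun ε hε => ⟨fun x => u (Nat.find (hseq x ε hε)), ?_,
    fun x => Nat.find_spec (hseq x ε hε)⟩⟩
  exact (measurable_from_nat (f := u)).comp (measurable_find (fun x => hseq x ε hε)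
    fun k => measurableSet_lt (hu k) (hmeas.add_const ε))

theorem stmt5 {X : Type*} [MeasurableSpace X] [StandardBorelSpace X]
    (μ : Measure X) [IsProbabilityMeasure μ] (n : ℕ) (hn : 1 ≤ n)
    (ℓ : (Fin n → ℝ) → Fin n → ℝ)
    (hℓmeas : Measurable fun q : (Fin n → ℝ) × Fin n => ℓ q.1 q.2)
    (hℓnn : ∀ α y, 0 ≤ ℓ α y)
    (p : X → Fin n → ℝ) (hp : Measurable p)
    (hpnn : ∀ x y, 0 ≤ p x y) (hpsum : ∀ x, ∑ y, p x y = 1) :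
    Measurable (fun x => ⨅ α : Fin n → ℝ, ∑ y, p x y * ℓ α y) ∧
    (⨅ h : { h : X → Fin n → ℝ // Measurable h },
        ∫⁻ x, ENNReal.ofReal (∑ y, p x y * ℓ (h.1 x) y) ∂μ)
      = ∫⁻ x, ENNReal.ofReal (⨅ α : Fin n → ℝ, ∑ y, p x y * ℓ α y) ∂μ := by
  have hnn : ∀ x α, 0 ≤ ∑ y, p x y * ℓ α y := fun x α =>
    Finset.sum_nonneg fun y _ => mul_nonneg (hpnn x y) (hℓnn α y)
  obtain ⟨u, hu⟩ := exists_seq_forall_isOpen_exists_mem ℓ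
  obtain ⟨hmeas, hsel⟩ := measurable_iInf_and_exists_measurable_lt_add
    (fun x α => ∑ y, p x y * ℓ α y) hnn u
    (fun k => Finset.measurable_sum _ fun y _ => ((measurable_pi_apply y).comp hp).mul_const _)
    (fun x α c hc => hu {s | ∑ y, p x y * s y < c}
      (isOpen_lt (by fun_prop) continuous_const) α hc)
  refine ⟨hmeas, le_antisymm (ENNReal.le_of_forall_pos_le_add fun ε hε _ => ?_)
    (le_iInf fun h => lintegral_mono fun x => ENNReal.ofReal_le_ofReal
      (ciInf_le ⟨0, by rintro _ ⟨α, rfl⟩; exact hnn x α⟩ (h.1 x)))⟩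
  obtain ⟨h, hh, hlt⟩ := hsel ε hε
  calc _ ≤ ∫⁻ x, ENNReal.ofReal (∑ y, p x y * ℓ (h x) y) ∂μ := iInf_le_of_le ⟨h, hh⟩ le_rfl
    _ ≤ ∫⁻ x, (ENNReal.ofReal (⨅ α : Fin n → ℝ, ∑ y, p x y * ℓ α y) + ε) ∂μ := by
        refine lintegral_mono fun x => (ENNReal.ofReal_le_ofReal (hlt x).le).trans ?_
        exact ENNReal.ofReal_add_le.trans (by rw [ENNReal.ofReal_coe_nnreal])
    _ = _ := by rw [lintegral_add_right _ measurable_const]; simp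
end

section
/- Let Y = {1, …, n}, X a measurable space, μ a probability measure on X, p: X → ℝⁿ a measurable map into the probability simplex, and L: Y × Y → [0, ∞) a function. Let P be a nonempty set of measurable predictors g: X → Y such that for every x ∈ X, {g(x) : g ∈ P} = Y. For g ∈ P set C(g, x) = Σ_{y ∈ Y} p(x)_y · L(g(x), y). Then: (i) for every x ∈ X, inf over g ∈ P of C(g, x) equals min over y′ ∈ Y of Σ_{y ∈ Y} p(x)_y · L(y′, y); (ii) the infimum over all measurable predictors g: X → Y of ∫ C(g, x) dμ(x) equals ∫ ( min over y′ ∈ Y of Σ_{y} p(x)_y · L(y′, y) ) dμ(x); and hence (iii) the minimizability gap M(P) = (inf over g ∈ P of ∫ C(g, x) dμ) − ∫ (inf over g ∈ P of C(g, x)) dμ equals the approximation error A(P) = (inf over g ∈ P of ∫ C(g, x) dμ) − (inf over all measurable g: X → Y of ∫ C(g, x) dμ). -/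
open MeasureTheory

/-- A finite family of measurable real functions has a measurable pointwise minimizer. -/
theorem exists_measurable_forall_le {X ι : Type*} [MeasurableSpace X] [Finite ι] [Nonempty ι]
    [MeasurableSpace ι] [DiscreteMeasurableSpace ι] {c : ι → X → ℝ} (hc : ∀ i, Measurable (c i)) :
    ∃ g : X → ι, Measurable g ∧ ∀ x i, c (g x) x ≤ c i x := by
  classical
  cases nonempty_fintype ι
  suffices H : ∀ s : Finset ι, s.Nonempty →
      ∃ g : X → ι, Measurable g ∧ ∀ x, ∀ i ∈ s, c (g x) x ≤ c i x by
    obtain ⟨g, hg, hle⟩ := H Finset.univ Finset.univ_nonempty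
    exact ⟨g, hg, fun x i => hle x i (Finset.mem_univ i)⟩
  intro s hs
  induction hs using Finset.Nonempty.cons_induction with
  | singleton a => exact ⟨fun _ => a, measurable_const, by simp⟩
  | cons a s ha hs ih =>
    obtain ⟨g, hg, hle⟩ := ih
    have hcg : Measurable fun x => c (g x) x :=
      (measurable_from_prod_countable_right (f := fun q : ι × X => c q.1 q.2) hc).comp
        (hg.prodMk measurable_id)
    refine ⟨fun x => if c a x ≤ c (g x) x then a else g x,
      Measurable.ite (measurableSet_le (hc a) hcg) measurable_const hg, fun x i hi => ?_⟩
    rcases Finset.mem_cons.1 hi with rfl | hi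
    · by_cases h : c i x ≤ c (g x) x
      · simp [h]
      · simpa [h] using (not_le.1 h).le
    · by_cases h : c a x ≤ c (g x) x
      · simpa [h] using h.trans (hle x i hi)
      · simpa [h] using hle x i hi

/-- The infimum of the risk over measurable selections from a finite family of nonnegative
integrable functions is the integral of the pointwise minimum. -/
theorem iInf_integral_eq_integral_iInf {X ι : Type*} [MeasurableSpace X] (μ : Measure X)
    [Finite ι] [Nonempty ι] [MeasurableSpace ι] [DiscreteMeasurableSpace ι] {c : ι → X → ℝ}
    (hc : ∀ i, Measurable (c i)) (hnn : ∀ i x, 0 ≤ c i x) (hint : ∀ i, Integrable (c i) μ) :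
    ⨅ g : {g : X → ι // Measurable g}, ∫ x, c (g.1 x) x ∂μ = ∫ x, ⨅ i, c i x ∂μ := by
  classical
  cases nonempty_fintype ι
  obtain ⟨g, hg, hle⟩ := exists_measurable_forall_le hc
  have hmin (x : X) : ⨅ i, c i x = c (g x) x :=
    le_antisymm (ciInf_le (Set.finite_range _).bddBelow (g x)) (le_ciInf (hle x))
  simp_rw [hmin]
  refine IsLeast.csInf_eq ⟨⟨⟨g, hg⟩, rfl⟩, ?_⟩
  rintro _ ⟨⟨f, hf⟩, rfl⟩
  have hcf : Measurable fun x => c (f x) x :=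
    (measurable_from_prod_countable_right (f := fun q : ι × X => c q.1 q.2) hc).comp
      (hf.prodMk measurable_id)
  refine integral_mono_of_nonneg (.of_forall fun x => hnn _ x) ?_ (.of_forall fun x => hle x _)
  refine (integrable_finsetSum Finset.univ fun i _ => hint i).mono' hcf.aestronglyMeasurable
    (.of_forall fun x => ?_)
  rw [Real.norm_of_nonneg (hnn _ x)]
  exact Finset.single_le_sum (f := fun i => c i x) (fun i _ => hnn i x) (Finset.mem_univ (f x))

theorem stmt6 {X : Type*} [MeasurableSpace X] (μ : Measure X) [IsProbabilityMeasure μ]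
    (n : ℕ) (hn : 1 ≤ n)
    (p : X → Fin n → ℝ) (hp : Measurable p)
    (hpnn : ∀ x y, 0 ≤ p x y) (hpsum : ∀ x, ∑ y, p x y = 1)
    (L : Fin n → Fin n → ℝ) (hL : ∀ y' y, 0 ≤ L y' y)
    (P : Set (X → Fin n)) (hPne : P.Nonempty)
    (hPmeas : ∀ g ∈ P, Measurable g)
    (hPfull : ∀ x : X, {y : Fin n | ∃ g ∈ P, g x = y} = Set.univ) :
    (∀ x : X, (⨅ g : P, ∑ y, p x y * L (g.1 x) y) = ⨅ y' : Fin n, ∑ y, p x y * L y' y) ∧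
    ((⨅ g : { g : X → Fin n // Measurable g }, ∫ x, ∑ y, p x y * L (g.1 x) y ∂μ)
      = ∫ x, (⨅ y' : Fin n, ∑ y, p x y * L y' y) ∂μ) ∧
    ((⨅ g : P, ∫ x, ∑ y, p x y * L (g.1 x) y ∂μ)
        - ∫ x, (⨅ g : P, ∑ y, p x y * L (g.1 x) y) ∂μ
      = (⨅ g : P, ∫ x, ∑ y, p x y * L (g.1 x) y ∂μ)
        - ⨅ g : { g : X → Fin n // Measurable g }, ∫ x, ∑ y, p x y * L (g.1 x) y ∂μ) := by
  have : Nonempty (Fin n) := ⟨⟨0, hn⟩⟩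
  have hpy (y : Fin n) : Measurable fun x => p x y := (measurable_pi_apply y).comp hp
  have hpint (y : Fin n) : Integrable (fun x => p x y) μ := by
    refine (integrable_const (1 : ℝ)).mono' (hpy y).aestronglyMeasurable (.of_forall fun x => ?_)
    rw [Real.norm_of_nonneg (hpnn x y), ← hpsum x]
    exact Finset.single_le_sum (fun i _ => hpnn x i) (Finset.mem_univ y)
  have hpointwise (x : X) :
      (⨅ g : P, ∑ y, p x y * L (g.1 x) y) = ⨅ y' : Fin n, ∑ y, p x y * L y' y := by
    have hsurj : Function.Surjective fun g : P => g.1 x := fun y => by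
      obtain ⟨g, hg, hgx⟩ : y ∈ {y | ∃ g ∈ P, g x = y} := hPfull x ▸ Set.mem_univ y
      exact ⟨⟨g, hg⟩, hgx⟩
    exact hsurj.iInf_comp fun y' => ∑ y, p x y * L y' y
  have hbayes := iInf_integral_eq_integral_iInf μ (c := fun y' x => ∑ y, p x y * L y' y)
    (fun y' => Finset.measurable_fun_sum _ fun y _ => (hpy y).mul_const _)
    (fun y' x => Finset.sum_nonneg fun y _ => mul_nonneg (hpnn x y) (hL y' y))
    (fun y' => integrable_finsetSum _ fun y _ => (hpint y).mul_const _)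
  exact ⟨hpointwise, hbayes, by rw [hbayes]; simp_rw [hpointwise]⟩
end

section
/- Fix an integer n ≥ 2, Λ > 0, a measurable space X with probability measure μ, and a measurable label function y: X → {1, …, n} (a deterministic distribution). Let H be a set of measurable functions h: X → ℝⁿ such that {h(x) : h ∈ H} = [−Λ, Λ]ⁿ for every x ∈ X. For h ∈ H set s_h(x) = Σ_{j ≠ y(x)} exp(h(x)_j − h(x)_{y(x)}), and assume s_h is μ-integrable for every h ∈ H with inf over h ∈ H of ∫ s_h dμ finite; write R*₀(H) for this infimum. For τ ∈ [0, 2), the comp-sum loss of h is f_τ(s_h(x)), and its minimizability gap is M_τ(H) = (inf over h ∈ H of ∫ f_τ(s_h(x)) dμ) − ∫ ( inf over α ∈ [−Λ, Λ]ⁿ of f_τ( Σ_{j ≠ y(x)} exp(α_j − α_{y(x)}) ) ) dμ. Then for every τ ∈ [0, 2): M_τ(H) ≤ f_τ(R*₀(H)) − f_τ((n−1)·e^{−2Λ}), and moreover the upper bound τ ↦ f_τ(R*₀(H)) − f_τ((n−1)·e^{−2Λ}) is a non-increasing function of τ on [0, 2). -/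
open MeasureTheory

/-- `f_τ(u) = log(1+u)` if `τ = 1`, and `((1+u)^{1-τ} - 1)/(1-τ)` otherwise. -/
noncomputable def fcomp (τ u : ℝ) : ℝ :=
  if τ = 1 then Real.log (1 + u) else ((1 + u) ^ (1 - τ) - 1) / (1 - τ)

/-- `s_h(x) = ∑_{j ≠ y} exp(v_j - v_y)` for the score vector `v`. -/
noncomputable def sumExp (n : ℕ) (y : Fin n) (v : Fin n → ℝ) : ℝ :=
  ∑ j ∈ Finset.univ.erase y, Real.exp (v j - v y)

theorem hasDerivAt_fcomp (τ : ℝ) {u : ℝ} (hu : 0 < 1 + u) :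
    HasDerivAt (fcomp τ) ((1 + u) ^ (-τ)) u := by
  have hlin : HasDerivAt (fun v : ℝ => 1 + v) 1 u := (hasDerivAt_id u).const_add 1
  by_cases hτ : τ = 1
  · have hf : fcomp τ = fun v => Real.log (1 + v) := by
      funext v
      simp [fcomp, hτ]
    rw [hf, hτ, Real.rpow_neg_one, ← one_div]
    exact hlin.log hu.ne'
  · have hf : fcomp τ = fun v => ((1 + v) ^ (1 - τ) - 1) / (1 - τ) := by
      funext v
      simp [fcomp, hτ]
    have h1 : 1 - τ ≠ 0 := sub_ne_zero.mpr (Ne.symm hτ)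
    have hval : 1 * (1 - τ) * (1 + u) ^ (1 - τ - 1) / (1 - τ) = (1 + u) ^ (-τ) := by
      rw [show 1 - τ - 1 = -τ by ring]
      field_simp
    rw [hf, ← hval]
    exact ((hlin.rpow_const (Or.inl hu.ne')).sub_const 1).div_const (1 - τ)

theorem continuousOn_fcomp (τ : ℝ) : ContinuousOn (fcomp τ) (Set.Ici 0) := fun u hu =>
  (hasDerivAt_fcomp τ (by linarith [Set.mem_Ici.mp hu])).continuousAt.continuousWithinAt

theorem fcomp_zero (τ : ℝ) : fcomp τ 0 = 0 := by
  simp [fcomp]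

theorem monotoneOn_fcomp (τ : ℝ) : MonotoneOn (fcomp τ) (Set.Ici 0) := by
  refine monotoneOn_of_hasDerivWithinAt_nonneg (convex_Ici 0) (continuousOn_fcomp τ)
    (f' := fun u => (1 + u) ^ (-τ)) (fun u hu => ?_) (fun u hu => ?_) <;>
  rw [interior_Ici] at hu <;> have hu : 0 < u := hu
  · exact (hasDerivAt_fcomp τ (by linarith)).hasDerivWithinAt
  · positivity

theorem fcomp_nonneg (τ : ℝ) {u : ℝ} (hu : 0 ≤ u) : 0 ≤ fcomp τ u := by
  simpa [fcomp_zero] using monotoneOn_fcomp τ Set.self_mem_Ici hu hu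

/-- Increments of `fcomp τ` decrease as `τ` grows. -/
theorem fcomp_sub_le_fcomp_sub {τ τ' : ℝ} (hτ : τ ≤ τ') {a b : ℝ} (ha : 0 ≤ a) (hab : a ≤ b) :
    fcomp τ' b - fcomp τ' a ≤ fcomp τ b - fcomp τ a := by
  have hmono : MonotoneOn (fun u => fcomp τ u - fcomp τ' u) (Set.Ici 0) := by
    refine monotoneOn_of_hasDerivWithinAt_nonneg (convex_Ici 0)
      ((continuousOn_fcomp τ).sub (continuousOn_fcomp τ'))
      (f' := fun u => (1 + u) ^ (-τ) - (1 + u) ^ (-τ')) (fun u hu => ?_) (fun u hu => ?_) <;>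
    rw [interior_Ici] at hu <;> have hu : 0 < u := hu
    · exact ((hasDerivAt_fcomp τ (by linarith)).sub
        (hasDerivAt_fcomp τ' (by linarith))).hasDerivWithinAt
    · exact sub_nonneg.mpr (Real.rpow_le_rpow_of_exponent_le (by linarith) (by linarith))
  have := hmono (Set.mem_Ici.mpr ha) (Set.mem_Ici.mpr (ha.trans hab)) hab
  simp only at this
  linarith

theorem concaveOn_fcomp {τ : ℝ} (hτ : 0 ≤ τ) : ConcaveOn ℝ (Set.Ici 0) (fcomp τ) := by
  have hpos : ∀ u ∈ interior (Set.Ici (0 : ℝ)), 0 < u := fun u hu => by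
    rwa [interior_Ici] at hu
  refine AntitoneOn.concaveOn_of_deriv (convex_Ici 0) (continuousOn_fcomp τ)
    (fun u hu => (hasDerivAt_fcomp τ
      (by linarith [hpos u hu])).differentiableAt.differentiableWithinAt)
    (fun u hu v hv huv => ?_)
  have hu := hpos u hu
  have hv := hpos v hv
  rw [(hasDerivAt_fcomp τ (by linarith)).deriv, (hasDerivAt_fcomp τ (by linarith)).deriv]
  exact Real.rpow_le_rpow_of_nonpos (by linarith) (by linarith) (by linarith)

/-- A concave function lies below its tangent lines. -/
theorem fcomp_le_tangent {τ : ℝ} (hτ : 0 ≤ τ) {r s : ℝ} (hr : 0 ≤ r) (hs : 0 ≤ s) :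
    fcomp τ s ≤ fcomp τ r + (1 + r) ^ (-τ) * (s - r) := by
  have hd := hasDerivAt_fcomp τ (u := r) (by linarith)
  rcases lt_trichotomy r s with h | rfl | h
  · have := (concaveOn_fcomp hτ).slope_le_of_hasDerivAt hr hs h hd
    rw [slope_def_field, div_le_iff₀ (by linarith)] at this
    linarith
  · simp
  · have := (concaveOn_fcomp hτ).le_slope_of_hasDerivAt hs hr h hd
    rw [slope_def_field, le_div_iff₀ (by linarith)] at this
    linarith

theorem sumExp_nonneg (n : ℕ) (y : Fin n) (v : Fin n → ℝ) : 0 ≤ sumExp n y v :=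
  Finset.sum_nonneg fun _ _ => (Real.exp_pos _).le

theorem le_sumExp {n : ℕ} {Λ : ℝ} (y : Fin n) {v : Fin n → ℝ}
    (hv : ∀ j, v j ∈ Set.Icc (-Λ) Λ) :
    ((n : ℝ) - 1) * Real.exp (-(2 * Λ)) ≤ sumExp n y v := by
  have hle := Finset.card_nsmul_le_sum (Finset.univ.erase y) (fun j => Real.exp (v j - v y))
    (Real.exp (-(2 * Λ))) fun j _ => Real.exp_le_exp.mpr (by linarith [(hv j).1, (hv y).2])
  rw [Finset.card_erase_of_mem (Finset.mem_univ y), Finset.card_univ, Fintype.card_fin,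
    nsmul_eq_mul, Nat.cast_pred y.pos] at hle
  exact hle

/-- The score vector minimizing `sumExp n y` over the box `[-Λ, Λ]ⁿ`. -/
theorem sumExp_ite (n : ℕ) (y : Fin n) (Λ : ℝ) :
    sumExp n y (fun j => if j = y then Λ else -Λ) = ((n : ℝ) - 1) * Real.exp (-(2 * Λ)) := by
  have : ∀ j ∈ Finset.univ.erase y,
      Real.exp ((if j = y then Λ else -Λ) - (if y = y then Λ else -Λ))
        = Real.exp (-(2 * Λ)) := fun j hj => by
    rw [if_neg (Finset.ne_of_mem_erase hj), if_pos rfl]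
    ring_nf
  rw [sumExp, Finset.sum_congr rfl this, Finset.sum_const,
    Finset.card_erase_of_mem (Finset.mem_univ y), Finset.card_univ, Fintype.card_fin,
    nsmul_eq_mul, Nat.cast_pred y.pos]

theorem iInf_fcomp_sumExp (τ : ℝ) {n : ℕ} (y : Fin n) {Λ : ℝ} (hΛ : 0 < Λ) :
    (⨅ α : {v : Fin n → ℝ // ∀ j, v j ∈ Set.Icc (-Λ) Λ}, fcomp τ (sumExp n y α.1))
      = fcomp τ (((n : ℝ) - 1) * Real.exp (-(2 * Λ))) := by
  have hmem : ∀ j, (if j = y then Λ else -Λ) ∈ Set.Icc (-Λ) Λ := fun j => by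
    split_ifs <;> constructor <;> linarith
  have hleast : IsLeast (Set.range fun α : {v : Fin n → ℝ // ∀ j, v j ∈ Set.Icc (-Λ) Λ} =>
      fcomp τ (sumExp n y α.1)) (fcomp τ (((n : ℝ) - 1) * Real.exp (-(2 * Λ)))) := by
    refine ⟨⟨⟨_, hmem⟩, by simp only [sumExp_ite]⟩, ?_⟩
    rintro _ ⟨α, rfl⟩
    refine monotoneOn_fcomp τ ?_ (sumExp_nonneg n y α.1) (le_sumExp y α.2)
    rw [← sumExp_ite n y]
    exact sumExp_nonneg _ _ _
  exact hleast.csInf_eq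

/-- Jensen's inequality passes to the infimum over a family of nonnegative functions. -/
theorem iInf_integral_fcomp_le {X ι : Type*} [MeasurableSpace X] (μ : Measure X)
    [IsProbabilityMeasure μ] [Nonempty ι] {τ : ℝ} (hτ : 0 ≤ τ) (s : ι → X → ℝ)
    (hs : ∀ i x, 0 ≤ s i x) (hint : ∀ i, Integrable (s i) μ) :
    ⨅ i, ∫ x, fcomp τ (s i x) ∂μ ≤ fcomp τ (⨅ i, ∫ x, s i x ∂μ) := by
  set R := ⨅ i, ∫ x, s i x ∂μ
  have hR : 0 ≤ R := Real.iInf_nonneg fun i => integral_nonneg (hs i)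
  have hd : 0 < (1 + R) ^ (-τ) := by positivity
  refine le_of_forall_pos_le_add fun ε hε => ?_
  obtain ⟨i, hi⟩ := exists_lt_of_ciInf_lt
    (lt_add_of_pos_right R (div_pos hε hd) : (⨅ i, ∫ x, s i x ∂μ) < R + ε / (1 + R) ^ (-τ))
  have hbdd : BddBelow (Set.range fun i => ∫ x, fcomp τ (s i x) ∂μ) :=
    ⟨0, by rintro _ ⟨j, rfl⟩; exact integral_nonneg fun x => fcomp_nonneg τ (hs j x)⟩
  have htan : Integrable (fun x => (1 + R) ^ (-τ) * (s i x - R)) μ :=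
    ((hint i).sub (integrable_const R)).const_mul _
  calc ⨅ i, ∫ x, fcomp τ (s i x) ∂μ ≤ ∫ x, fcomp τ (s i x) ∂μ := ciInf_le hbdd i
    _ ≤ ∫ x, (fcomp τ R + (1 + R) ^ (-τ) * (s i x - R)) ∂μ :=
        integral_mono_of_nonneg (.of_forall fun x => fcomp_nonneg τ (hs i x))
          ((integrable_const _).add htan) (.of_forall fun x => fcomp_le_tangent hτ hR (hs i x))
    _ = fcomp τ R + (1 + R) ^ (-τ) * (∫ x, s i x ∂μ - R) := by
        rw [integral_add (integrable_const _) htan, integral_const_mul,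
          integral_sub (hint i) (integrable_const R)]
        simp
    _ ≤ fcomp τ R + ε := by
        rw [add_le_add_iff_left, mul_comm, ← le_div_iff₀ hd]
        linarith

theorem stmt11 {X : Type*} [MeasurableSpace X] (μ : Measure X) [IsProbabilityMeasure μ]
    (n : ℕ) (hn : 2 ≤ n) (Λ : ℝ) (hΛ : 0 < Λ)
    (y : X → Fin n) (hy : Measurable y)
    (H : Set (X → Fin n → ℝ)) (hHne : H.Nonempty)
    (hHmeas : ∀ h ∈ H, Measurable h)
    (hHval : ∀ x : X, {v : Fin n → ℝ | ∃ h ∈ H, h x = v}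
      = {v : Fin n → ℝ | ∀ j, v j ∈ Set.Icc (-Λ) Λ})
    (hint : ∀ h ∈ H, Integrable (fun x => sumExp n (y x) (h x)) μ) :
    ∀ τ ∈ Set.Ico (0 : ℝ) 2,
      (((⨅ h : H, ∫ x, fcomp τ (sumExp n (y x) (h.1 x)) ∂μ)
          - ∫ x, (⨅ α : {v : Fin n → ℝ // ∀ j, v j ∈ Set.Icc (-Λ) Λ},
              fcomp τ (sumExp n (y x) α.1)) ∂μ)
        ≤ fcomp τ (⨅ h : H, ∫ x, sumExp n (y x) (h.1 x) ∂μ)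
            - fcomp τ (((n : ℝ) - 1) * Real.exp (-(2 * Λ)))) ∧
      ∀ τ' : ℝ, τ ≤ τ' → τ' < 2 →
        fcomp τ' (⨅ h : H, ∫ x, sumExp n (y x) (h.1 x) ∂μ)
            - fcomp τ' (((n : ℝ) - 1) * Real.exp (-(2 * Λ)))
          ≤ fcomp τ (⨅ h : H, ∫ x, sumExp n (y x) (h.1 x) ∂μ)
            - fcomp τ (((n : ℝ) - 1) * Real.exp (-(2 * Λ))) := by
  intro τ hτ
  have : Nonempty H := hHne.to_subtype
  have hbox : ∀ h ∈ H, ∀ x j, h x j ∈ Set.Icc (-Λ) Λ := fun h hh x =>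
    (hHval x).subset ⟨h, hh, rfl⟩
  have hc : 0 ≤ ((n : ℝ) - 1) * Real.exp (-(2 * Λ)) := by
    have : (2 : ℝ) ≤ n := by exact_mod_cast hn
    exact mul_nonneg (by linarith) (Real.exp_pos _).le
  have hcR : ((n : ℝ) - 1) * Real.exp (-(2 * Λ)) ≤
      ⨅ h : H, ∫ x, sumExp n (y x) (h.1 x) ∂μ := le_ciInf fun h => by
    simpa using integral_mono (integrable_const _) (hint h.1 h.2)
      fun x => le_sumExp (y x) (hbox h.1 h.2 x)
  refine ⟨?_, fun τ' hττ' _ => fcomp_sub_le_fcomp_sub hττ' hc hcR⟩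
  have hgap := iInf_integral_fcomp_le μ hτ.1 (fun (h : H) x => sumExp n (y x) (h.1 x))
    (fun h x => sumExp_nonneg _ _ _) (fun h => hint h.1 h.2)
  simp only [iInf_fcomp_sumExp τ _ hΛ, integral_const, probReal_univ, one_smul]
  exact sub_le_sub_right hgap _
end

section
/- Let H be a nonempty set, X a measurable space, and μ a probability measure on X. For i = 1, 2, let C_i: H × X → ℝ be such that x ↦ C_i(h, x) is measurable and μ-integrable for each h ∈ H; let C_i*(x) = inf over h ∈ H of C_i(h, x), assumed measurable and μ-integrable, and set ΔC_i(h, x) = C_i(h, x) − C_i*(x) (which is nonnegative). Define E_i(h) = ∫ C_i(h, x) dμ, E_i* = inf over h ∈ H of E_i(h) (assumed finite), and M_i = E_i* − ∫ C_i*(x) dμ. Let Γ: ℝ → ℝ be non-decreasing and concave on [0, ∞), and suppose that for every h ∈ H and every x ∈ X, ΔC₂(h, x) ≤ Γ(ΔC₁(h, x)). Then for every h ∈ H: E₂(h) − E₂* + M₂ ≤ Γ( E₁(h) − E₁* + M₁ ). -/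
open MeasureTheory

/-- A convex function on a set of reals has a supporting line at each interior point. -/
theorem ConvexOn.exists_supporting_line {s : Set ℝ} {f : ℝ → ℝ} (hf : ConvexOn ℝ s f) {m : ℝ}
    (hm : m ∈ interior s) : ∃ a, ∀ y ∈ s, f m + a * (y - m) ≤ f y := by
  refine ⟨derivWithin f (Set.Ioi m) m, fun y hy => ?_⟩
  rcases lt_trichotomy y m with hlt | rfl | hgt
  · have h := (hf.slope_le_leftDeriv_of_mem_interior hy hm hlt).trans
      (hf.leftDeriv_le_rightDeriv_of_mem_interior hm)
    rw [slope_def_field, div_le_iff₀ (by linarith)] at h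
    linarith
  · simp
  · have h := hf.rightDeriv_le_slope_of_mem_interior hm hy hgt
    rw [slope_def_field, le_div_iff₀ (by linarith)] at h
    linarith

/-- **Jensen's inequality** on `[0, ∞)` for a minorant `g` of `Γ ∘ f`, with no continuity of `Γ`
at `0` and no integrability of `Γ ∘ f` required. -/
theorem ConcaveOn.integral_le_map_integral_of_le {X : Type*} [MeasurableSpace X]
    {μ : Measure X} [IsProbabilityMeasure μ] {Γ : ℝ → ℝ} (hΓ : ConcaveOn ℝ (Set.Ici 0) Γ)
    {f g : X → ℝ} (hf : Integrable f μ) (hg : Integrable g μ) (hf0 : 0 ≤ f)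
    (hle : ∀ x, g x ≤ Γ (f x)) : ∫ x, g x ∂μ ≤ Γ (∫ x, f x ∂μ) := by
  rcases (integral_nonneg hf0 : 0 ≤ ∫ x, f x ∂μ).eq_or_lt with h0 | hpos
  · have hfz : f =ᵐ[μ] 0 := (integral_eq_zero_iff_of_nonneg hf0 hf).1 h0.symm
    have hg0 : ∀ᵐ x ∂μ, g x ≤ Γ 0 := by
      filter_upwards [hfz] with x hx
      simpa [hx] using hle x
    rw [← h0]
    simpa using integral_mono_ae hg (integrable_const (Γ 0)) hg0
  · set m := ∫ x, f x ∂μ with hm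
    obtain ⟨a, ha⟩ := hΓ.neg.exists_supporting_line (m := m) (by simpa using hpos)
    have hsub : Integrable (fun x => f x - m) μ := hf.sub (integrable_const m)
    calc ∫ x, g x ∂μ ≤ ∫ x, (Γ m - a * (f x - m)) ∂μ := by
          refine integral_mono hg ((integrable_const _).sub (hsub.const_mul a)) fun x => ?_
          have h := ha (f x) (hf0 x)
          simp only [Pi.neg_apply] at h
          linarith [hle x]
      _ = Γ m := by
          rw [integral_sub (integrable_const _) (hsub.const_mul a), integral_const_mul,
            integral_sub hf (integrable_const m), ← hm]
          simp

theorem stmt13 {H : Type*} [Nonempty H] {X : Type*} [MeasurableSpace X]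
    (μ : Measure X) [IsProbabilityMeasure μ]
    (C₁ C₂ : H → X → ℝ)
    (hmeas₁ : ∀ h, Measurable (C₁ h)) (hint₁ : ∀ h, Integrable (C₁ h) μ)
    (hmeas₂ : ∀ h, Measurable (C₂ h)) (hint₂ : ∀ h, Integrable (C₂ h) μ)
    (hbdd₁ : ∀ x, BddBelow (Set.range fun h => C₁ h x))
    (hbdd₂ : ∀ x, BddBelow (Set.range fun h => C₂ h x))
    (hsmeas₁ : Measurable fun x => ⨅ h, C₁ h x)
    (hsint₁ : Integrable (fun x => ⨅ h, C₁ h x) μ)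
    (hsmeas₂ : Measurable fun x => ⨅ h, C₂ h x)
    (hsint₂ : Integrable (fun x => ⨅ h, C₂ h x) μ)
    (hEbdd₁ : BddBelow (Set.range fun h => ∫ x, C₁ h x ∂μ))
    (hEbdd₂ : BddBelow (Set.range fun h => ∫ x, C₂ h x ∂μ))
    (Γ : ℝ → ℝ) (hΓmono : MonotoneOn Γ (Set.Ici 0)) (hΓconc : ConcaveOn ℝ (Set.Ici 0) Γ)
    (hpoint : ∀ h x, C₂ h x - (⨅ h', C₂ h' x) ≤ Γ (C₁ h x - ⨅ h', C₁ h' x)) :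
    ∀ h : H,
      (∫ x, C₂ h x ∂μ) - (⨅ h', ∫ x, C₂ h' x ∂μ)
          + ((⨅ h', ∫ x, C₂ h' x ∂μ) - ∫ x, (⨅ h', C₂ h' x) ∂μ)
        ≤ Γ ((∫ x, C₁ h x ∂μ) - (⨅ h', ∫ x, C₁ h' x ∂μ)
          + ((⨅ h', ∫ x, C₁ h' x ∂μ) - ∫ x, (⨅ h', C₁ h' x) ∂μ)) := by
  intro h
  rw [sub_add_sub_cancel, sub_add_sub_cancel, ← integral_sub (hint₂ h) hsint₂,
    ← integral_sub (hint₁ h) hsint₁]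
  exact hΓconc.integral_le_map_integral_of_le ((hint₁ h).sub hsint₁) ((hint₂ h).sub hsint₂)
    (fun x => sub_nonneg.2 (ciInf_le (hbdd₁ x) h)) (hpoint h)
end

section
/- Assume Φ: ℝ → ℝ is nonnegative, convex, twice continuously differentiable, and satisfies Φ′(0) > 0 and Φ″(0) > 0. Then there exist ε > 0 and a continuously differentiable function a: [0, ε] → ℝ such that: a(0) = 0; for every t ∈ [0, ε], ((1−t)/2)·Φ′(a(t)) = ((1+t)/2)·Φ′(−a(t)) and f_t attains its infimum over ℝ at a(t); a(t) > 0 for every t ∈ (0, ε]; and the derivative of a at 0 equals Φ′(0)/Φ″(0), so that lim_{t → 0⁺} a(t)/t = Φ′(0)/Φ″(0) > 0 (hence a(t) = Θ(t) as t → 0⁺). -/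
open Filter Topology

theorem HasDerivAt.exists_contDiffAt_rightInverse {g : ℝ → ℝ} {g' x : ℝ} (hd : HasDerivAt g g' x)
    (hg : ContDiffAt ℝ 1 g x) (hg' : g' ≠ 0) :
    ∃ a : ℝ → ℝ, a (g x) = x ∧ ContDiffAt ℝ 1 a (g x) ∧ HasDerivAt a g'⁻¹ (g x) ∧
      ∀ᶠ t in 𝓝 (g x), g (a t) = t := by
  have hs : HasStrictDerivAt g g' x := hg.hasStrictDerivAt' hd one_ne_zero
  have he := hs.hasStrictFDerivAt_equiv hg'
  exact ⟨hs.localInverse g g' x hg', he.localInverse_apply_image,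
    hg.to_localInverse he.hasFDerivAt one_ne_zero, (hs.to_localInverse hg').hasDerivAt,
    hs.eventually_right_inverse hg'⟩

theorem ConvexOn.le_of_hasDerivAt_zero {f : ℝ → ℝ} {x : ℝ} (hf : ConvexOn ℝ Set.univ f)
    (hx : HasDerivAt f 0 x) (u : ℝ) : f x ≤ f u := by
  refine hf.isMinOn_of_rightDeriv_eq_zero (x := x) (by simp) ?_ (Set.mem_univ u)
  exact hx.hasDerivWithinAt.derivWithin (uniqueDiffWithinAt_Ioi x)

theorem convexOn_ftrans_s14 {Φ : ℝ → ℝ} (hΦ : ConvexOn ℝ Set.univ Φ) {t : ℝ}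
    (ht : t ∈ Set.Icc (-1 : ℝ) 1) : ConvexOn ℝ Set.univ (ftrans Φ t) := by
  obtain ⟨h0, h1⟩ := ht
  have hneg : ConvexOn ℝ Set.univ fun u => Φ (-u) := by
    simpa using! hΦ.comp_linearMap (-LinearMap.id)
  exact (hΦ.smul (by linarith : 0 ≤ (1 - t) / 2)).add (hneg.smul (by linarith : 0 ≤ (1 + t) / 2))

theorem hasDerivAt_ftrans {Φ : ℝ → ℝ} (hΦ : Differentiable ℝ Φ) (t u : ℝ) :
    HasDerivAt (ftrans Φ t) ((1 - t) / 2 * deriv Φ u - (1 + t) / 2 * deriv Φ (-u)) u := by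
  have hneg : HasDerivAt (fun u => Φ (-u)) (deriv Φ (-u) * -1) u :=
    (hΦ (-u)).hasDerivAt.comp u (hasDerivAt_neg u)
  convert! ((hΦ u).hasDerivAt.const_mul ((1 - t) / 2)).add (hneg.const_mul ((1 + t) / 2)) using 1
  ring

theorem stmt14 (Φ : ℝ → ℝ) (hnn : ∀ x, 0 ≤ Φ x) (hconv : ConvexOn ℝ Set.univ Φ)
    (hC2 : ContDiff ℝ 2 Φ) (hd1 : 0 < deriv Φ 0) (hd2 : 0 < iteratedDeriv 2 Φ 0) :
    ∃ ε > (0 : ℝ), ∃ a : ℝ → ℝ,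
      a 0 = 0 ∧
      ContDiffOn ℝ 1 a (Set.Icc 0 ε) ∧
      (∀ t ∈ Set.Icc (0 : ℝ) ε,
        ((1 - t) / 2) * deriv Φ (a t) = ((1 + t) / 2) * deriv Φ (-(a t)) ∧
        ∀ u : ℝ, ftrans Φ t (a t) ≤ ftrans Φ t u) ∧
      (∀ t ∈ Set.Ioc (0 : ℝ) ε, 0 < a t) ∧
      HasDerivWithinAt a (deriv Φ 0 / iteratedDeriv 2 Φ 0) (Set.Icc 0 ε) 0 ∧
      Tendsto (fun t => a t / t) (𝓝[>] (0 : ℝ))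
        (𝓝 (deriv Φ 0 / iteratedDeriv 2 Φ 0)) ∧
      0 < deriv Φ 0 / iteratedDeriv 2 Φ 0 := by
  set φ := deriv Φ with hφ
  have hΦ : Differentiable ℝ Φ := hC2.differentiable two_ne_zero
  have hφC : ContDiff ℝ 1 φ := ContDiff.deriv' (n := 1) (by simpa [one_add_one_eq_two] using hC2)
  have hφd : HasDerivAt φ (iteratedDeriv 2 Φ 0) 0 := by
    rw [iteratedDeriv_succ, iteratedDeriv_one]
    exact (hφC.differentiable one_ne_zero 0).hasDerivAt
  have hφdn : HasDerivAt (fun u => φ (-u)) (-iteratedDeriv 2 Φ 0) 0 := by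
    have h : HasDerivAt φ (iteratedDeriv 2 Φ 0) (-0) := by simpa using hφd
    simpa [Function.comp_def] using h.comp 0 (hasDerivAt_neg 0)
  have hφCn : ContDiff ℝ 1 fun u => φ (-u) := hφC.comp contDiff_neg
  set q := φ 0 / iteratedDeriv 2 Φ 0 with hq
  have hqpos : 0 < q := div_pos hd1 hd2
  -- The first-order condition at `u` is solved explicitly by `t = g u`.
  set g : ℝ → ℝ := fun u => (φ u - φ (-u)) / (φ u + φ (-u)) with hgdef
  have hden : φ 0 + φ (-0) ≠ 0 := by simpa using hd1.ne'
  have hg0 : g 0 = 0 := by simp [hgdef]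
  have hgd : HasDerivAt g q⁻¹ 0 := by
    convert! (hφd.sub hφdn).div (hφd.add hφdn) hden using 1
    simp only [hq, neg_zero, Pi.sub_apply, Pi.add_apply]
    field_simp
    ring
  have hgC : ContDiffAt ℝ 1 g 0 :=
    (hφC.sub hφCn).contDiffAt.div (hφC.add hφCn).contDiffAt hden
  obtain ⟨a, ha0, haC, had, hinv⟩ := hgd.exists_contDiffAt_rightInverse hgC (inv_ne_zero hqpos.ne')
  rw [hg0] at ha0 haC had hinv
  rw [inv_inv] at had
  have hlim : Tendsto (fun t => a t / t) (𝓝[>] 0) (𝓝 q) := by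
    refine (had.tendsto_slope.mono_left (nhdsGT_le_nhdsNE 0)).congr fun t => ?_
    simp [slope_def_field, ha0]
  have hpos : ∀ᶠ t in 𝓝 0, 0 < t → 0 < a t := by
    refine eventually_nhdsWithin_iff (s := Set.Ioi (0 : ℝ)).1 ?_
    filter_upwards [hlim.eventually (lt_mem_nhds hqpos), self_mem_nhdsWithin] with t h ht
    exact (div_pos_iff_of_pos_right ht).1 h
  have hdenpos : ∀ᶠ t in 𝓝 0, 0 < φ (a t) + φ (-(a t)) := by
    have hc : ContinuousAt (fun t => φ (a t) + φ (-(a t))) 0 :=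
      ((hφC.add hφCn).continuous.continuousAt).comp haC.continuousAt
    refine hc.eventually (lt_mem_nhds ?_)
    simpa [ha0] using hd1
  have hall := (haC.eventually (by simp)).and (hinv.and (hpos.and
    (hdenpos.and (gt_mem_nhds (zero_lt_one' ℝ)))))
  obtain ⟨δ, hδ, hball⟩ := Metric.eventually_nhds_iff.1 hall
  have hmem : ∀ t ∈ Set.Icc 0 (δ / 2), dist t 0 < δ := fun t ht => by
    rw [Real.dist_eq, sub_zero, abs_of_nonneg ht.1]
    linarith [ht.2]
  refine ⟨δ / 2, half_pos hδ, a, ha0, fun t ht => (hball (hmem t ht)).1.contDiffWithinAt, ?_, ?_,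
    had.hasDerivWithinAt, hlim, hqpos⟩
  · intro t ht
    obtain ⟨-, hgt, -, hd, ht1⟩ := hball (hmem t ht)
    have hfoc : (1 - t) / 2 * φ (a t) = (1 + t) / 2 * φ (-(a t)) := by
      have := (div_eq_iff hd.ne').1 hgt
      linarith
    refine ⟨hfoc, (convexOn_ftrans_s14 hconv ⟨by linarith [ht.1], ht1.le⟩).le_of_hasDerivAt_zero ?_⟩
    simpa only [← hφ, hfoc, sub_self] using hasDerivAt_ftrans hΦ t (a t)
  · exact fun t ht => (hball (hmem t ⟨ht.1.le, ht.2⟩)).2.2.1 ht.1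
end

section
/- Let n ≥ 2 be an integer, Λ > 0, k ∈ {1, …, n}, and let ε ∈ [0, 1/2] satisfy ε ≤ (n−1)/(e^{2Λ} + n − 1). For α ∈ ℝⁿ define S_j(α) = e^{α_j} / Σ_{j′=1}^{n} e^{α_{j′}} and g(α) = −(1−ε)·log S_k(α) − (ε/(n−1))·Σ_{j ≠ k} log S_j(α). Then g attains its minimum over the cube [−Λ, Λ]ⁿ at the vector α* with α*_k = Λ and α*_j = −Λ for all j ≠ k; that is, g(α*) ≤ g(α) for every α ∈ [−Λ, Λ]ⁿ. -/
/-- The conditional error of the multinomial logistic loss at a point whose conditional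
distribution puts mass `1 - ε` on class `k` and `ε/(n-1)` on each other class, as a
function of the score vector `α`; here `S_j(α) = exp(α_j) / ∑_{j'} exp(α_{j'})`. -/
noncomputable def softCE (n : ℕ) (ε : ℝ) (k : Fin n) (α : Fin n → ℝ) : ℝ :=
  -(1 - ε) * Real.log (Real.exp (α k) / ∑ j', Real.exp (α j'))
    - (ε / ((n : ℝ) - 1)) * ∑ j ∈ Finset.univ.erase k,
        Real.log (Real.exp (α j) / ∑ j', Real.exp (α j'))

/-- The conditional error is the log-partition function minus the expected score. -/
theorem softCE_eq (n : ℕ) (hn : 2 ≤ n) (ε : ℝ) (k : Fin n) (α : Fin n → ℝ) :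
    softCE n ε k α = Real.log (∑ j, Real.exp (α j)) - (1 - ε) * α k
      - ε / ((n : ℝ) - 1) * ∑ j ∈ Finset.univ.erase k, α j := by
  have hZ : 0 < ∑ j, Real.exp (α j) := Finset.sum_pos (fun j _ => Real.exp_pos _) ⟨k, by simp⟩
  have hlog (j : Fin n) : Real.log (Real.exp (α j) / ∑ j', Real.exp (α j'))
      = α j - Real.log (∑ j', Real.exp (α j')) := by
    rw [Real.log_div (Real.exp_pos _).ne' hZ.ne', Real.log_exp]
  have hn2 : (2 : ℝ) ≤ n := by exact_mod_cast hn
  have hn1 : (n : ℝ) - 1 ≠ 0 := by linarith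
  simp only [softCE, hlog, Finset.sum_sub_distrib, Finset.sum_const, nsmul_eq_mul,
    Finset.card_erase_of_mem (Finset.mem_univ k), Finset.card_univ, Fintype.card_fin]
  rw [Nat.cast_sub (by lia), Nat.cast_one]
  field_simp
  ring

/-- The gradient inequality for the log-sum-exp function. -/
theorem sum_softmax_mul_sub_le {ι : Type*} [Fintype ι] [Nonempty ι] (α β : ι → ℝ) :
    ∑ j, Real.exp (β j) / (∑ i, Real.exp (β i)) * (α j - β j)
      ≤ Real.log (∑ j, Real.exp (α j)) - Real.log (∑ j, Real.exp (β j)) := by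
  have hZ (γ : ι → ℝ) : 0 < ∑ j, Real.exp (γ j) :=
    Finset.sum_pos (fun j _ => Real.exp_pos _) Finset.univ_nonempty
  have hJensen := convexOn_exp.map_sum_le (t := Finset.univ)
    (w := fun j => Real.exp (β j) / ∑ i, Real.exp (β i)) (p := fun j => α j - β j)
    (fun j _ => (div_pos (Real.exp_pos _) (hZ β)).le)
    (by rw [← Finset.sum_div, div_self (hZ β).ne']) (fun _ _ => Set.mem_univ _)
  rw [← Real.log_div (hZ α).ne' (hZ β).ne', Real.le_log_iff_exp_le (div_pos (hZ α) (hZ β))]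
  refine hJensen.trans_eq ?_
  rw [Finset.sum_div]
  refine Finset.sum_congr rfl fun j _ => ?_
  rw [smul_eq_mul, div_mul_eq_mul_div, ← Real.exp_add, add_sub_cancel]

theorem stmt19 (n : ℕ) (hn : 2 ≤ n) (Λ : ℝ) (hΛ : 0 < Λ) (k : Fin n)
    (ε : ℝ) (hε0 : 0 ≤ ε) (hεhalf : ε ≤ 1 / 2)
    (hε : ε ≤ ((n : ℝ) - 1) / (Real.exp (2 * Λ) + (n : ℝ) - 1)) :
    ∀ α : Fin n → ℝ, (∀ j, α j ∈ Set.Icc (-Λ) Λ) →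
      softCE n ε k (fun j => if j = k then Λ else -Λ) ≤ softCE n ε k α := by
  intro α hα
  have : Nonempty (Fin n) := ⟨k⟩
  have hn2 : (2 : ℝ) ≤ n := by exact_mod_cast hn
  have hn1 : 0 < (n : ℝ) - 1 := by linarith
  set β : Fin n → ℝ := fun j => if j = k then Λ else -Λ with hβ
  have hβk : β k = Λ := by simp [hβ]
  have hβj : ∀ j ∈ Finset.univ.erase k, β j = -Λ := fun j hj => by
    simp [hβ, Finset.ne_of_mem_erase hj]
  have hE : 0 < Real.exp (2 * Λ) := Real.exp_pos _
  set D := Real.exp (2 * Λ) + (n : ℝ) - 1 with hD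
  have hD0 : 0 < D := by linarith
  have hcard : ((Finset.univ.erase k).card : ℝ) = (n : ℝ) - 1 := by
    rw [Finset.card_erase_of_mem (Finset.mem_univ k), Finset.card_univ, Fintype.card_fin,
      Nat.cast_sub (by lia), Nat.cast_one]
  have hexp : Real.exp Λ = Real.exp (-Λ) * Real.exp (2 * Λ) := by
    rw [← Real.exp_add]; ring_nf
  have hZ : ∑ j, Real.exp (β j) = Real.exp (-Λ) * D := by
    rw [← Finset.add_sum_erase _ _ (Finset.mem_univ k), hβk,
      Finset.sum_congr rfl fun j hj => by rw [hβj j hj], Finset.sum_const, nsmul_eq_mul, hcard,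
      hexp, hD]
    ring
  have hgrad := sum_softmax_mul_sub_le α β
  have hoff : ∑ j ∈ Finset.univ.erase k, Real.exp (β j) / (∑ i, Real.exp (β i)) * (α j - β j)
      = Real.exp (-Λ) / (∑ i, Real.exp (β i)) * ∑ j ∈ Finset.univ.erase k, (α j - -Λ) := by
    rw [Finset.mul_sum]
    exact Finset.sum_congr rfl fun j hj => by rw [hβj j hj]
  rw [← Finset.add_sum_erase _ _ (Finset.mem_univ k), hoff, hβk] at hgrad
  have hpk : Real.exp Λ / ∑ j, Real.exp (β j) = 1 - ((n : ℝ) - 1) / D := by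
    rw [hZ, hexp, mul_div_mul_left _ _ (Real.exp_pos _).ne', eq_sub_iff_add_eq, ← add_div,
      div_eq_one_iff_eq hD0.ne']
    ring
  have hpj : Real.exp (-Λ) / ∑ j, Real.exp (β j) = ((n : ℝ) - 1) / D / ((n : ℝ) - 1) := by
    rw [hZ]
    have := (Real.exp_pos (-Λ)).ne'
    field_simp
  rw [hpk, hpj] at hgrad
  have hS : 0 ≤ ∑ j ∈ Finset.univ.erase k, (α j - -Λ) :=
    Finset.sum_nonneg fun j _ => by linarith [(hα j).1]
  have hk : 0 ≤ (((n : ℝ) - 1) / D - ε) * (Λ - α k) :=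
    mul_nonneg (by linarith) (by linarith [(hα k).2])
  have hj := mul_le_mul_of_nonneg_right (div_le_div_of_nonneg_right hε hn1.le) hS
  have hsum : ∑ j ∈ Finset.univ.erase k, (α j - -Λ)
      = ∑ j ∈ Finset.univ.erase k, α j - ∑ j ∈ Finset.univ.erase k, β j := by
    rw [← Finset.sum_sub_distrib]
    exact Finset.sum_congr rfl fun j hj => by rw [hβj j hj]
  rw [softCE_eq n hn, softCE_eq n hn, hβk]
  rw [hsum] at hgrad hj
  linarith
end
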